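/- arXiv:1311.6525 — 3 statements merged into one kernel-verified Lean document; each statement's English description precedes it below -/
import Mathlib

section
/- Let N ≥ 1 and let (ψ_n) be a sequence of locally integrable functions on ℝ^N with weak gradients such that sup_n ∫_{ℝ^N} e^{-|x|²/2} |∇ψ_n|² dx < ∞ and ∫_{ℝ^N} (1+|x|²) e^{-|x|²/2} ψ_n dx = 0 for all n. Then there exist a subsequence (ψ_{n_k}) and a function ψ with ∫ e^{-|x|²/2} |∇ψ|² dx < ∞ such that ∫_{ℝ^N} e^{-|x|²/2} (ψ_{n_k}(x) - ψ(x))² dx → 0 as k → ∞. That is, the embedding of the Gaussian homogeneous Sobolev space H into L²(e^{-|x|²/2} dx) is compact. -/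
open MeasureTheory Real Filter ENNReal

noncomputable section

/-- `g` is the weak gradient of `ψ` on `ℝ^N`. -/
def HasWeakGradient (N : ℕ) (ψ : EuclideanSpace ℝ (Fin N) → ℝ)
    (g : EuclideanSpace ℝ (Fin N) → EuclideanSpace ℝ (Fin N)) : Prop :=
  MeasureTheory.LocallyIntegrable ψ volume ∧ MeasureTheory.LocallyIntegrable g volume ∧
  ∀ (i : Fin N) (φ : EuclideanSpace ℝ (Fin N) → ℝ), ContDiff ℝ (⊤ : ℕ∞) φ → HasCompactSupport φ →
    ∫ x, ψ x * fderiv ℝ φ x (EuclideanSpace.single i 1) = -∫ x, g x i * φ x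

open scoped RealInnerProductSpace

set_option linter.unusedSectionVars false

section GaussianWeight

variable {E : Type*} [NormedAddCommGroup E] [InnerProductSpace ℝ E] [FiniteDimensional ℝ E]
  [MeasurableSpace E] [BorelSpace E]

/-- Gaussian functions of negative exponent are integrable. -/
theorem integrable_exp_neg_mul_norm_sq {b : ℝ} (hb : 0 < b) :
    Integrable (fun x : E => Real.exp (-b * ‖x‖ ^ 2)) := by
  refine Integrable.of_integral_ne_zero ?_
  rw [GaussianFourier.integral_rexp_neg_mul_sq_norm hb]
  positivity

variable (E) in
/-- The measure `e^{-|x|²/2} dx`. -/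
def gaussWeight : Measure E :=
  volume.withDensity fun x => ENNReal.ofReal (Real.exp (-‖x‖ ^ 2 / 2))

theorem measurable_gaussDensity :
    Measurable fun x : E => ENNReal.ofReal (Real.exp (-‖x‖ ^ 2 / 2)) := by
  fun_prop

theorem lintegral_gaussWeight (f : E → ℝ≥0∞) :
    ∫⁻ x, f x ∂gaussWeight E = ∫⁻ x, ENNReal.ofReal (Real.exp (-‖x‖ ^ 2 / 2)) * f x := by
  rw [gaussWeight, lintegral_withDensity_eq_lintegral_mul_non_measurable _ measurable_gaussDensity
    (by simp)]
  rfl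

theorem integral_gaussWeight {F : Type*} [NormedAddCommGroup F] [NormedSpace ℝ F] (f : E → F) :
    ∫ x, f x ∂gaussWeight E = ∫ x, Real.exp (-‖x‖ ^ 2 / 2) • f x := by
  rw [gaussWeight, integral_withDensity_eq_integral_toReal_smul measurable_gaussDensity
    (by simp)]
  simp [ENNReal.toReal_ofReal, Real.exp_nonneg]

theorem integrable_gaussWeight_iff {F : Type*} [NormedAddCommGroup F] [NormedSpace ℝ F]
    {f : E → F} :
    Integrable f (gaussWeight E) ↔ Integrable fun x => Real.exp (-‖x‖ ^ 2 / 2) • f x := by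
  rw [gaussWeight, integrable_withDensity_iff_integrable_smul' measurable_gaussDensity
    (by simp)]
  simp [ENNReal.toReal_ofReal, Real.exp_nonneg]

theorem gaussWeight_absolutelyContinuous : gaussWeight E ≪ volume :=
  withDensity_absolutelyContinuous _ _

theorem absolutelyContinuous_gaussWeight : (volume : Measure E) ≪ gaussWeight E :=
  withDensity_absolutelyContinuous' measurable_gaussDensity.aemeasurable
    (ae_of_all _ fun x => by simp [Real.exp_pos])

theorem lintegral_exp_gaussWeight_lt_top {b : ℝ} (hb : b < 1 / 2) :
    ∫⁻ x, ENNReal.ofReal (Real.exp (b * ‖x‖ ^ 2)) ∂gaussWeight E < ∞ := by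
  rw [lintegral_gaussWeight]
  have h := (integrable_exp_neg_mul_norm_sq (E := E) (sub_pos.2 hb)).lintegral_lt_top
  refine lt_of_eq_of_lt (lintegral_congr fun x => ?_) h
  rw [← ENNReal.ofReal_mul (Real.exp_nonneg _), ← Real.exp_add]
  ring_nf

instance : IsFiniteMeasure (gaussWeight E) := by
  refine ⟨?_⟩
  simpa using lintegral_exp_gaussWeight_lt_top (E := E) (b := 0) (by norm_num)

instance : NeZero (gaussWeight E) := by
  refine ⟨fun h => ?_⟩
  have := absolutelyContinuous_gaussWeight (E := E)
  rw [h, Measure.absolutelyContinuous_zero_iff] at this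
  exact NeZero.ne _ this

theorem lintegral_sq_gaussWeight_lt_top :
    ∫⁻ x, ‖1 + ‖x‖ ^ 2‖ₑ ^ 2 ∂gaussWeight E < ∞ := by
  have h := lintegral_exp_gaussWeight_lt_top (E := E) (b := 1 / 4) (by norm_num)
  have h' := ENNReal.mul_lt_top (ENNReal.ofReal_lt_top (r := 64)) h
  rw [← lintegral_const_mul _ (by fun_prop)] at h'
  refine lt_of_le_of_lt (lintegral_mono fun x => ?_) h'
  rw [Real.enorm_eq_ofReal (by positivity), ← ENNReal.ofReal_pow (by positivity),
    ← ENNReal.ofReal_mul (by norm_num)]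
  refine ENNReal.ofReal_le_ofReal ?_
  have h1 := Real.add_one_le_exp (1 / 8 * ‖x‖ ^ 2)
  have h2 : Real.exp (1 / 4 * ‖x‖ ^ 2) = Real.exp (1 / 8 * ‖x‖ ^ 2) ^ 2 := by
    rw [← Real.exp_nat_mul]; push_cast; ring_nf
  rw [h2]
  nlinarith [sq_nonneg ‖x‖, Real.exp_pos (1 / 8 * ‖x‖ ^ 2)]

theorem lintegral_norm_sq_gaussWeight_lt_top :
    ∫⁻ x : E, ‖x‖ₑ ^ 2 ∂gaussWeight E < ∞ := by
  refine lt_of_le_of_lt (lintegral_mono fun x => ?_) (lintegral_sq_gaussWeight_lt_top (E := E))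
  gcongr
  rw [← enorm_norm x, Real.enorm_eq_ofReal (by positivity), Real.enorm_eq_ofReal (by positivity)]
  refine ENNReal.ofReal_le_ofReal ?_
  nlinarith [sq_nonneg (‖x‖ - 1 / 2)]

/-- Cauchy–Schwarz for the lower Lebesgue integral. -/
theorem lintegral_mul_sq_le {α : Type*} [MeasurableSpace α] {μ : Measure α} {f g : α → ℝ≥0∞}
    (hf : AEMeasurable f μ) (hg : AEMeasurable g μ) :
    (∫⁻ x, f x * g x ∂μ) ^ 2 ≤ (∫⁻ x, f x ^ 2 ∂μ) * ∫⁻ x, g x ^ 2 ∂μ := by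
  have h := ENNReal.lintegral_mul_le_Lp_mul_Lq μ Real.HolderConjugate.two_two hf hg
  have h2 := pow_le_pow_left' h 2
  refine h2.trans_eq ?_
  rw [mul_pow, ← ENNReal.rpow_natCast, ← ENNReal.rpow_natCast, ← ENNReal.rpow_mul,
    ← ENNReal.rpow_mul]
  simp

/-- The rotation of angle `t` in the plane spanned by the two factors of `E × E`. -/
def prodRotation (t : ℝ) : E × E →ₗ[ℝ] E × E :=
  ((Real.cos t • LinearMap.fst ℝ E E) + Real.sin t • LinearMap.snd ℝ E E).prod
    ((-Real.sin t) • LinearMap.fst ℝ E E + Real.cos t • LinearMap.snd ℝ E E)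

@[simp]
theorem prodRotation_apply (t : ℝ) (p : E × E) :
    prodRotation t p = (Real.cos t • p.1 + Real.sin t • p.2,
      (-Real.sin t) • p.1 + Real.cos t • p.2) := rfl

theorem abs_det_prodRotation (t : ℝ) : |LinearMap.det (prodRotation (E := E) t)| = 1 := by
  set J : E × E →ₗ[ℝ] E × E := (LinearMap.fst ℝ E E).prod (-LinearMap.snd ℝ E E) with hJ
  have h1 : prodRotation (E := E) t * (J * prodRotation t * J) = 1 := by
    refine LinearMap.ext fun p => ?_
    have hc := Real.cos_sq_add_sin_sq t
    refine Prod.ext ?_ ?_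
    · simp only [hJ, Module.End.mul_apply, prodRotation_apply, LinearMap.prod_apply, Function.prod,
        LinearMap.fst_apply, LinearMap.neg_apply, LinearMap.snd_apply, Module.End.one_apply]
      linear_combination (norm := module) hc • p.1
    · simp only [hJ, Module.End.mul_apply, prodRotation_apply, LinearMap.prod_apply, Function.prod,
        LinearMap.fst_apply, LinearMap.neg_apply, LinearMap.snd_apply, Module.End.one_apply]
      linear_combination (norm := module) hc • p.2
  have h2 : J * J = 1 := by
    refine LinearMap.ext fun p => ?_
    simp [hJ]
  have h3 := congrArg LinearMap.det h1
  have h4 := congrArg LinearMap.det h2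
  simp only [map_mul, map_one] at h3 h4
  have h5 : (LinearMap.det (prodRotation (E := E) t)) ^ 2 = 1 := by
    linear_combination h3 - LinearMap.det (prodRotation (E := E) t) ^ 2 * h4
  rw [← sq_abs] at h5
  exact (pow_eq_one_iff_of_nonneg (abs_nonneg _) two_ne_zero).1 h5

theorem norm_sq_prodRotation (t : ℝ) (p : E × E) :
    ‖(prodRotation t p).1‖ ^ 2 + ‖(prodRotation t p).2‖ ^ 2 = ‖p.1‖ ^ 2 + ‖p.2‖ ^ 2 := by
  have hc := Real.cos_sq_add_sin_sq t
  simp only [prodRotation_apply, norm_add_sq_real, norm_smul, inner_smul_left, inner_smul_right,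
    mul_pow, Real.norm_eq_abs, sq_abs, abs_neg]
  simp
  linear_combination (‖p.1‖ ^ 2 + ‖p.2‖ ^ 2) * hc

theorem measurable_prodRotation (t : ℝ) : Measurable (prodRotation (E := E) t) := by
  exact (LinearMap.continuous_of_finiteDimensional _).measurable

/-- The Gaussian weight on `E × E` is invariant under rotations. -/
theorem measurePreserving_prodRotation (t : ℝ) :
    MeasurePreserving (prodRotation (E := E) t) ((gaussWeight E).prod (gaussWeight E))
      ((gaussWeight E).prod (gaussWeight E)) := by
  have hvol : MeasurePreserving (prodRotation (E := E) t) (volume.prod volume)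
      (volume.prod volume) := by
    refine ⟨measurable_prodRotation t, ?_⟩
    have h := abs_det_prodRotation (E := E) t
    have h0 : LinearMap.det (prodRotation (E := E) t) ≠ 0 := by
      intro h0; simp [h0] at h
    rw [Measure.map_linearMap_addHaar_eq_smul_addHaar _ h0, abs_inv, h]
    simp
  refine ⟨measurable_prodRotation t, ?_⟩
  rw [gaussWeight, prod_withDensity measurable_gaussDensity measurable_gaussDensity]
  have hm : Measurable fun z : E × E => ENNReal.ofReal (Real.exp (-‖z.1‖ ^ 2 / 2)) *
      ENNReal.ofReal (Real.exp (-‖z.2‖ ^ 2 / 2)) := by fun_prop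
  refine Measure.ext fun s hs => ?_
  rw [Measure.map_apply (measurable_prodRotation t) hs, withDensity_apply _ hs,
    withDensity_apply _ (measurable_prodRotation t hs), 
    ← hvol.setLIntegral_comp_preimage hs hm]
  refine lintegral_congr fun p => ?_
  have h := norm_sq_prodRotation t p
  rw [← ENNReal.ofReal_mul (Real.exp_nonneg _), ← Real.exp_add,
    ← ENNReal.ofReal_mul (Real.exp_nonneg _), ← Real.exp_add]
  congr 2
  linarith

end GaussianWeight

section Rotation

variable {E : Type*} [NormedAddCommGroup E] [InnerProductSpace ℝ E] [FiniteDimensional ℝ E]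
  [MeasurableSpace E] [BorelSpace E]

theorem hasDerivAt_comp_prodRotation {f : E → ℝ} (hf : ContDiff ℝ 1 f) (p : E × E) (t : ℝ) :
    HasDerivAt (fun τ => f (prodRotation τ p).1)
      (fderiv ℝ f (prodRotation t p).1 (prodRotation t p).2) t := by
  have h1 : HasDerivAt (fun τ => (prodRotation τ p).1) (prodRotation t p).2 t := by
    simpa using! ((Real.hasDerivAt_cos t).smul_const p.1).add
      ((Real.hasDerivAt_sin t).smul_const p.2)
  exact (hf.differentiable one_ne_zero _).hasFDerivAt.comp_hasDerivAt t h1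

theorem enorm_sub_prodRotation_sq_le {f : E → ℝ} (hf : ContDiff ℝ 1 f) (p : E × E) {t : ℝ}
    (ht : 0 ≤ t) :
    ‖f p.1 - f (prodRotation t p).1‖ₑ ^ 2 ≤ ENNReal.ofReal t *
      ∫⁻ τ in Set.Ioc 0 t,
        ‖fderiv ℝ f (prodRotation τ p).1‖ₑ ^ 2 * ‖(prodRotation τ p).2‖ₑ ^ 2 := by
  have hf' : Continuous (fderiv ℝ f) := hf.continuous_fderiv one_ne_zero
  have hc1 : Continuous fun τ => (prodRotation τ p).1 := by
    simp only [prodRotation_apply]; fun_prop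
  have hc2 : Continuous fun τ => (prodRotation τ p).2 := by
    simp only [prodRotation_apply]; fun_prop
  have hc : Continuous fun τ => fderiv ℝ f (prodRotation τ p).1 (prodRotation τ p).2 := by
    fun_prop
  have h0 : (prodRotation 0 p).1 = p.1 := by simp
  have h1 : f (prodRotation t p).1 - f p.1 =
      ∫ τ in Set.Ioc 0 t, fderiv ℝ f (prodRotation τ p).1 (prodRotation τ p).2 := by
    rw [← intervalIntegral.integral_of_le ht,
      intervalIntegral.integral_eq_sub_of_hasDerivAt
        (fun τ _ => hasDerivAt_comp_prodRotation hf p τ) (hc.intervalIntegrable _ _), h0]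
  have hm : AEMeasurable (fun τ => ‖fderiv ℝ f (prodRotation τ p).1‖ₑ * ‖(prodRotation τ p).2‖ₑ)
      (volume.restrict (Set.Ioc 0 t)) := by
    exact ((hf'.comp hc1).measurable.enorm.mul hc2.measurable.enorm).aemeasurable
  calc ‖f p.1 - f (prodRotation t p).1‖ₑ ^ 2
      = ‖f (prodRotation t p).1 - f p.1‖ₑ ^ 2 := by rw [← enorm_neg, neg_sub]
    _ ≤ (∫⁻ τ in Set.Ioc 0 t, 1 *
          (‖fderiv ℝ f (prodRotation τ p).1‖ₑ * ‖(prodRotation τ p).2‖ₑ)) ^ 2 := by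
        rw [h1]
        gcongr
        refine (enorm_integral_le_lintegral_enorm _).trans (lintegral_mono fun τ => ?_)
        rw [one_mul]
        exact ContinuousLinearMap.le_opENorm _ _
    _ ≤ _ := by
        refine (lintegral_mul_sq_le aemeasurable_const hm).trans_eq ?_
        simp [mul_pow]

/-- Rotating the argument of a smooth function costs at most the Gaussian Dirichlet energy. -/
theorem lintegral_sub_prodRotation_le_of_contDiff {f : E → ℝ} (hf : ContDiff ℝ 1 f) {t : ℝ}
    (ht : 0 ≤ t) (R : ℝ) (hR : 0 ≤ R) :
    ∫⁻ p in {p : E × E | ‖p.1‖ ^ 2 + ‖p.2‖ ^ 2 ≤ R ^ 2}, ‖f p.1 - f (prodRotation t p).1‖ₑ ^ 2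
        ∂((gaussWeight E).prod (gaussWeight E)) ≤
      ENNReal.ofReal t ^ 2 * ((∫⁻ x in Metric.closedBall 0 R, ‖fderiv ℝ f x‖ₑ ^ 2 ∂gaussWeight E) *
        ∫⁻ y, ‖y‖ₑ ^ 2 ∂gaussWeight E) := by
  have hf' : Continuous (fderiv ℝ f) := hf.continuous_fderiv one_ne_zero
  set S := {p : E × E | ‖p.1‖ ^ 2 + ‖p.2‖ ^ 2 ≤ R ^ 2} with hS
  have hSm : MeasurableSet S := measurableSet_le (by fun_prop) (by fun_prop)
  set G : E × E → ℝ≥0∞ := fun p => ‖fderiv ℝ f p.1‖ₑ ^ 2 * ‖p.2‖ₑ ^ 2 with hG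
  have hGm : Measurable G := by
    exact ((hf'.measurable.comp measurable_fst).enorm.pow_const 2).mul
      (measurable_snd.enorm.pow_const 2)
  have hrot : ∀ τ : ℝ, ∫⁻ p in S, G (prodRotation τ p)
      ∂((gaussWeight E).prod (gaussWeight E)) =
      ∫⁻ p in S, G p ∂((gaussWeight E).prod (gaussWeight E)) := by
    intro τ
    rw [← (measurePreserving_prodRotation τ).setLIntegral_comp_preimage hSm hGm]
    congr 2
    ext p
    simp only [hS, Set.mem_preimage, Set.mem_ofPred_eq, norm_sq_prodRotation]
  have hjoint : Measurable fun q : (E × E) × ℝ => G (prodRotation q.2 q.1) := by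
    refine hGm.comp (Continuous.measurable ?_)
    simp only [prodRotation_apply]
    fun_prop
  have hSub : S ⊆ Metric.closedBall 0 R ×ˢ Set.univ := by
    intro p hp
    simp only [hS, Set.mem_ofPred_eq] at hp
    simp only [Set.mem_prod, mem_closedBall_zero_iff, Set.mem_univ, and_true]
    exact (sq_le_sq₀ (norm_nonneg _) hR).1 (by nlinarith [sq_nonneg ‖p.2‖])
  calc _ ≤ ∫⁻ p in S, (ENNReal.ofReal t * ∫⁻ τ in Set.Ioc 0 t, G (prodRotation τ p))
        ∂((gaussWeight E).prod (gaussWeight E)) :=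
        lintegral_mono fun p => enorm_sub_prodRotation_sq_le hf p ht
    _ = ENNReal.ofReal t * ∫⁻ τ in Set.Ioc 0 t, ∫⁻ p in S, G (prodRotation τ p)
        ∂((gaussWeight E).prod (gaussWeight E)) := by
        rw [lintegral_const_mul' _ _ ENNReal.ofReal_ne_top,
          lintegral_lintegral_swap (f := fun p τ => G (prodRotation τ p)) hjoint.aemeasurable]
    _ = ENNReal.ofReal t ^ 2 * ∫⁻ p in S, G p ∂((gaussWeight E).prod (gaussWeight E)) := by
        simp only [hrot]
        simp
        ring
    _ ≤ ENNReal.ofReal t ^ 2 * ∫⁻ p in Metric.closedBall 0 R ×ˢ Set.univ, G p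
          ∂((gaussWeight E).prod (gaussWeight E)) := by
        gcongr
    _ = _ := by
        rw [← Measure.prod_restrict, Measure.restrict_univ]
        congr 1
        exact lintegral_prod_mul (hf'.measurable.enorm.pow_const 2).aemeasurable
          (measurable_enorm.pow_const 2).aemeasurable

end Rotation

section Mollification

open scoped Convolution

variable {N : ℕ}

local notation "𝔼" => EuclideanSpace ℝ (Fin N)

theorem fderiv_convolution_eq_innerSL {f : 𝔼 → ℝ} {g : 𝔼 → 𝔼}
    (h : HasWeakGradient N f g) {r : 𝔼 → ℝ} (hr : ContDiff ℝ (⊤ : ℕ∞) r)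
    (hrc : HasCompactSupport r) (x : 𝔼) :
    fderiv ℝ (r ⋆[ContinuousLinearMap.lsmul ℝ ℝ, volume] f) x =
      innerSL ℝ (∫ z, r (x - z) • g z) := by
  obtain ⟨hf, hg, hfg⟩ := h
  have hr1 : ContDiff ℝ 1 r := hr.of_le (by exact_mod_cast le_top)
  have hxc : HasCompactSupport fun z => r (x - z) := hrc.comp_homeomorph (Homeomorph.subLeft x)
  have hgi : Integrable fun z => r (x - z) • g z :=
    hg.integrable_smul_left_of_hasCompactSupport (by have := hr.continuous; fun_prop) hxc
  rw [← convolution_flip, (hrc.hasFDerivAt_convolution_right _ hf hr1 x).fderiv]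
  refine ContinuousLinearMap.coe_injective
    ((EuclideanSpace.basisFun (Fin N) ℝ).toBasis.ext fun i => ?_)
  have h1 := hfg i (fun z => r (x - z)) (by fun_prop) hxc
  have h2 : ∀ z, fderiv ℝ (fun z => r (x - z)) z (EuclideanSpace.single i 1) =
      -fderiv ℝ r (x - z) (EuclideanSpace.single i 1) := by
    intro z
    have h := ((hr1.differentiable one_ne_zero (x - z)).hasFDerivAt).comp z
      ((hasFDerivAt_const x z).sub (hasFDerivAt_id z))
    rw [show (fun z => r (x - z)) = r ∘ HSub.hSub x from rfl, h.fderiv]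
    simp
  have h3 : (∫ z, r (x - z) • g z) i = ∫ z, g z i * r (x - z) := by
    have := (EuclideanSpace.proj (𝕜 := ℝ) i).integral_comp_comm hgi
    refine this.symm.trans (integral_congr_ae (ae_of_all _ fun z => ?_))
    simp [mul_comm]
  simp only [h2, mul_neg, integral_neg, neg_inj] at h1
  simp only [OrthonormalBasis.coe_toBasis, EuclideanSpace.basisFun_apply,
    ContinuousLinearMap.coe_coe, innerSL_apply_apply, EuclideanSpace.inner_single_right]
  rw [convolution_precompR_apply _ hf (hrc.fderiv ℝ) (hr1.continuous_fderiv one_ne_zero)]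
  simp only [convolution, ContinuousLinearMap.flip_apply, ContinuousLinearMap.lsmul_apply]
  rw [one_mul, h3, ← h1]
  simp [mul_comm]

theorem enorm_fderiv_convolution_sq_le {f : 𝔼 → ℝ} {g : 𝔼 → 𝔼}
    (h : HasWeakGradient N f g) (ρ : ContDiffBump (0 : 𝔼)) (x : 𝔼) :
    ‖fderiv ℝ (ρ.normed volume ⋆[ContinuousLinearMap.lsmul ℝ ℝ, volume] f) x‖ₑ ^ 2 ≤
      ∫⁻ z, ENNReal.ofReal (ρ.normed volume (x - z)) * ‖g z‖ₑ ^ 2 := by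
  rw [fderiv_convolution_eq_innerSL h ρ.contDiff_normed ρ.hasCompactSupport_normed x]
  have hrcont : Continuous (ρ.normed (volume : Measure 𝔼)) := ρ.continuous_normed
  have hrm : Measurable fun z => ENNReal.ofReal (ρ.normed volume (x - z)) := by fun_prop
  have hfin : ∀ᵐ z : 𝔼, ENNReal.ofReal (ρ.normed volume (x - z)) < ∞ := by simp
  set ν := (volume : Measure 𝔼).withDensity fun z => ENNReal.ofReal (ρ.normed volume (x - z))
    with hν
  have hν1 : ν Set.univ = 1 := by
    rw [hν, withDensity_apply _ MeasurableSet.univ, Measure.restrict_univ,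
      ← ofReal_integral_eq_lintegral_ofReal, integral_sub_left_eq_self, ρ.integral_normed]
    · simp
    · exact ρ.integrable_normed.comp_sub_left x
    · exact ae_of_all _ fun z => ρ.nonneg_normed _
  have hgm : AEMeasurable (fun z => ‖g z‖ₑ) ν :=
    (h.2.1.aestronglyMeasurable.mono_ac (withDensity_absolutelyContinuous _ _)).enorm
  have key := lintegral_mul_sq_le (μ := ν) (f := fun _ => 1) aemeasurable_const hgm
  have e1 : ‖innerSL ℝ (∫ z, ρ.normed volume (x - z) • g z)‖ₑ =
      ‖∫ z, ρ.normed volume (x - z) • g z‖ₑ := by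
    rw [← ofReal_norm, innerSL_apply_norm, ofReal_norm]
  have e2 : ∀ F : 𝔼 → ℝ≥0∞, ∫⁻ z, F z ∂ν =
      ∫⁻ z, ENNReal.ofReal (ρ.normed volume (x - z)) * F z := by
    intro F
    rw [hν, lintegral_withDensity_eq_lintegral_mul_non_measurable _ hrm hfin]
    rfl
  rw [e1, ← e2]
  refine le_trans ?_ (key.trans_eq (by simp [hν1]))
  gcongr
  refine (enorm_integral_le_lintegral_enorm _).trans_eq ?_
  rw [e2]
  refine lintegral_congr fun z => ?_
  rw [enorm_smul, one_mul, Real.enorm_eq_ofReal (ρ.nonneg_normed _)]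

theorem lintegral_fderiv_convolution_le {f : 𝔼 → ℝ} {g : 𝔼 → 𝔼}
    (h : HasWeakGradient N f g) (ρ : ContDiffBump (0 : 𝔼)) {R : ℝ} (h1 : ρ.rOut ≤ 1)
    (h2 : ρ.rOut * R ≤ 1) :
    ∫⁻ x in Metric.closedBall 0 R,
      ‖fderiv ℝ (ρ.normed volume ⋆[ContinuousLinearMap.lsmul ℝ ℝ, volume] f) x‖ₑ ^ 2
        ∂gaussWeight 𝔼 ≤
      ENNReal.ofReal (Real.exp (3 / 2)) * ∫⁻ x, ‖g x‖ₑ ^ 2 ∂gaussWeight 𝔼 := by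
  have hrcont : Continuous (ρ.normed (volume : Measure 𝔼)) := ρ.continuous_normed
  have hgm : AEMeasurable (fun z => ‖g z‖ₑ ^ 2) volume :=
    h.2.1.aestronglyMeasurable.enorm.pow_const 2
  have hpt : ∀ x ∈ Metric.closedBall (0 : 𝔼) R, ∀ z,
      ENNReal.ofReal (Real.exp (-‖x‖ ^ 2 / 2)) * (ENNReal.ofReal (ρ.normed volume (x - z))) ≤
      ENNReal.ofReal (Real.exp (3 / 2)) * ENNReal.ofReal (Real.exp (-‖z‖ ^ 2 / 2)) *
        ENNReal.ofReal (ρ.normed volume (x - z)) := by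
    intro x hx z
    by_cases hz : x - z ∈ Metric.ball (0 : 𝔼) ρ.rOut
    · gcongr
      rw [← ENNReal.ofReal_mul (Real.exp_nonneg _), ← Real.exp_add]
      refine ENNReal.ofReal_le_ofReal (Real.exp_le_exp.2 ?_)
      rw [mem_closedBall_zero_iff] at hx
      rw [mem_ball_zero_iff] at hz
      have h3 : ‖z‖ ≤ ‖x‖ + ρ.rOut := by
        have := norm_sub_norm_le z x
        rw [norm_sub_rev] at this
        linarith
      have h4 : ‖z‖ ^ 2 ≤ (‖x‖ + ρ.rOut) ^ 2 := by gcongr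
      have h5 : ρ.rOut * ‖x‖ ≤ 1 :=
        (mul_le_mul_of_nonneg_left hx ρ.rOut_pos.le).trans h2
      nlinarith [ρ.rOut_pos]
    · have : ρ.normed volume (x - z) = 0 := by
        rw [← Function.notMem_support, ρ.support_normed_eq]
        exact hz
      simp [this]
  have hint1 : ∀ z, ∫⁻ x, ENNReal.ofReal (ρ.normed volume (x - z)) = 1 := by
    intro z
    rw [lintegral_sub_right_eq_self (fun x => ENNReal.ofReal (ρ.normed volume x)),
      ← ofReal_integral_eq_lintegral_ofReal ρ.integrable_normed
      (ae_of_all _ fun z => ρ.nonneg_normed _), ρ.integral_normed]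
    simp
  calc _ ≤ ∫⁻ x in Metric.closedBall 0 R,
        (∫⁻ z, ENNReal.ofReal (ρ.normed volume (x - z)) * ‖g z‖ₑ ^ 2) ∂gaussWeight 𝔼 :=
        lintegral_mono fun x => enorm_fderiv_convolution_sq_le h ρ x
    _ = ∫⁻ x in Metric.closedBall 0 R, ENNReal.ofReal (Real.exp (-‖x‖ ^ 2 / 2)) *
        (∫⁻ z, ENNReal.ofReal (ρ.normed volume (x - z)) * ‖g z‖ₑ ^ 2) := by
        rw [← lintegral_indicator measurableSet_closedBall, lintegral_gaussWeight,
          ← lintegral_indicator measurableSet_closedBall]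
        refine lintegral_congr fun x => ?_
        by_cases hx : x ∈ Metric.closedBall (0 : 𝔼) R <;> simp [hx]
    _ ≤ ∫⁻ x in Metric.closedBall 0 R, ∫⁻ z, ENNReal.ofReal (Real.exp (3 / 2)) *
        ENNReal.ofReal (Real.exp (-‖z‖ ^ 2 / 2)) *
        ENNReal.ofReal (ρ.normed volume (x - z)) * ‖g z‖ₑ ^ 2 := by
        refine setLIntegral_mono' measurableSet_closedBall fun x hx => ?_
        rw [← lintegral_const_mul' _ _ ENNReal.ofReal_ne_top]
        refine lintegral_mono fun z => ?_
        rw [← mul_assoc]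
        exact mul_le_mul_left (hpt x hx z) _
    _ ≤ ∫⁻ x, ∫⁻ z, ENNReal.ofReal (Real.exp (3 / 2)) *
        ENNReal.ofReal (Real.exp (-‖z‖ ^ 2 / 2)) *
        ENNReal.ofReal (ρ.normed volume (x - z)) * ‖g z‖ₑ ^ 2 :=
        setLIntegral_le_lintegral _ _
    _ = ∫⁻ z, ∫⁻ x, ENNReal.ofReal (Real.exp (3 / 2)) *
        ENNReal.ofReal (Real.exp (-‖z‖ ^ 2 / 2)) *
        ENNReal.ofReal (ρ.normed volume (x - z)) * ‖g z‖ₑ ^ 2 := by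
        refine lintegral_lintegral_swap (AEMeasurable.mul ?_ hgm.comp_snd)
        exact Measurable.aemeasurable (by fun_prop)
    _ = ∫⁻ z, ENNReal.ofReal (Real.exp (3 / 2)) *
        (ENNReal.ofReal (Real.exp (-‖z‖ ^ 2 / 2)) * ‖g z‖ₑ ^ 2) := by
        refine lintegral_congr fun z => ?_
        rw [lintegral_mul_const _ (by fun_prop), lintegral_const_mul _ (by fun_prop), hint1]
        ring
    _ = _ := by
        rw [lintegral_const_mul' _ _ ENNReal.ofReal_ne_top, lintegral_gaussWeight]

/-- Rotating the argument of a function with a weak gradient costs at most its Gaussian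
Dirichlet energy. -/
theorem lintegral_sub_prodRotation_le {f : 𝔼 → ℝ} {g : 𝔼 → 𝔼}
    (h : HasWeakGradient N f g) {t : ℝ} (ht : 0 ≤ t) :
    ∫⁻ p, ‖f p.1 - f (prodRotation t p).1‖ₑ ^ 2 ∂((gaussWeight 𝔼).prod (gaussWeight 𝔼)) ≤
      ENNReal.ofReal t ^ 2 * (ENNReal.ofReal (Real.exp (3 / 2)) *
        (∫⁻ x, ‖g x‖ₑ ^ 2 ∂gaussWeight 𝔼) * ∫⁻ y : 𝔼, ‖y‖ₑ ^ 2 ∂gaussWeight 𝔼) := by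
  let ρ : ℕ → ContDiffBump (0 : 𝔼) := fun n =>
    ⟨1 / (n + 1) / 2, 1 / (n + 1), by positivity, half_lt_self (by positivity)⟩
  set F : ℕ → 𝔼 → ℝ := fun n =>
    (ρ n).normed volume ⋆[ContinuousLinearMap.lsmul ℝ ℝ, volume] f with hF
  set S : ℕ → Set (𝔼 × 𝔼) := fun n => {p | ‖p.1‖ ^ 2 + ‖p.2‖ ^ 2 ≤ (n : ℝ) ^ 2} with hS
  have hSm : ∀ n, MeasurableSet (S n) := fun n => measurableSet_le (by fun_prop) (by fun_prop)
  have hFc : ∀ n, ContDiff ℝ 1 (F n) := fun n =>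
    (ρ n).hasCompactSupport_normed.contDiff_convolution_left _
      ((ρ n).contDiff_normed (n := 1)) h.1
  have hFcont : ∀ n, Continuous (F n) := fun n => (hFc n).continuous
  have hae : ∀ᵐ x ∂gaussWeight 𝔼, Tendsto (fun n => F n x) atTop (nhds (f x)) := by
    refine gaussWeight_absolutelyContinuous.ae_le
      (ContDiffBump.ae_convolution_tendsto_right_of_locallyIntegrable (K := 2)
        tendsto_one_div_add_atTop_nhds_zero_nat (Eventually.of_forall fun n => ?_) h.1)
    change 1 / ((n : ℝ) + 1) ≤ 2 * (1 / (n + 1) / 2)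
    linarith
  have hq : Measure.QuasiMeasurePreserving (Prod.fst : 𝔼 × 𝔼 → 𝔼)
      ((gaussWeight 𝔼).prod (gaussWeight 𝔼)) (gaussWeight 𝔼) :=
    Measure.quasiMeasurePreserving_fst
  have hae1 := hq.ae hae
  have hae2 := (hq.comp (measurePreserving_prodRotation t).quasiMeasurePreserving).ae hae
  set H : ℕ → 𝔼 × 𝔼 → ℝ≥0∞ := fun n =>
    (S n).indicator fun p => ‖F n p.1 - F n (prodRotation t p).1‖ₑ ^ 2 with hH
  have hHm : ∀ n, Measurable (H n) := by
    intro n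
    refine Measurable.indicator ?_ (hSm n)
    have := (hFcont n).measurable
    have := measurable_prodRotation (E := 𝔼) t
    fun_prop
  have hlim : ∀ᵐ p ∂((gaussWeight 𝔼).prod (gaussWeight 𝔼)),
      ‖f p.1 - f (prodRotation t p).1‖ₑ ^ 2 = liminf (fun n => H n p) atTop := by
    filter_upwards [hae1, hae2] with p hp1 hp2
    have hp3 : Tendsto (fun n => ‖F n p.1 - F n (prodRotation t p).1‖ₑ ^ 2) atTop
        (nhds (‖f p.1 - f (prodRotation t p).1‖ₑ ^ 2)) :=
      ((ENNReal.continuous_pow 2).tendsto _).comp (hp1.sub hp2).enorm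
    refine (Tendsto.liminf_eq (hp3.congr' ?_)).symm
    have hev : ∀ᶠ n : ℕ in atTop, ‖p.1‖ ^ 2 + ‖p.2‖ ^ 2 ≤ (n : ℝ) ^ 2 :=
      ((tendsto_pow_atTop two_ne_zero).comp tendsto_natCast_atTop_atTop).eventually_ge_atTop _
    filter_upwards [hev] with n hn
    exact (Set.indicator_of_mem (s := S n) hn
      (fun p => ‖F n p.1 - F n (prodRotation t p).1‖ₑ ^ 2)).symm
  rw [lintegral_congr_ae hlim]
  refine (lintegral_liminf_le hHm).trans ?_
  refine (liminf_le_liminf (v := fun _ => _) (Eventually.of_forall fun n => ?_)).trans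
    (liminf_const _).le
  simp only [hH]
  rw [lintegral_indicator (hSm n)]
  refine (lintegral_sub_prodRotation_le_of_contDiff (hFc n) ht n n.cast_nonneg).trans ?_
  gcongr
  refine lintegral_fderiv_convolution_le h (ρ n) ?_ ?_
  · change 1 / ((n : ℝ) + 1) ≤ 1
    rw [div_le_one (by positivity)]
    linarith [n.cast_nonneg (α := ℝ)]
  · change 1 / ((n : ℝ) + 1) * n ≤ 1
    rw [div_mul_eq_mul_div, div_le_one (by positivity)]
    linarith

end Mollification

section WeakCompactness

variable {α F : Type*} [MeasurableSpace α] {μ : Measure α} [NormedAddCommGroup F]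

theorem eLpNorm_two_sq_eq_lintegral (f : α → F) :
    eLpNorm f 2 μ ^ 2 = ∫⁻ x, ‖f x‖ₑ ^ 2 ∂μ := by
  have := eLpNorm_nnreal_pow_eq_lintegral (f := f) (μ := μ) (p := 2) two_ne_zero
  simpa using this

theorem memLp_two_iff_lintegral_lt_top {f : α → F} (hf : AEStronglyMeasurable f μ) :
    MemLp f 2 μ ↔ ∫⁻ x, ‖f x‖ₑ ^ 2 ∂μ < ∞ := by
  rw [← eLpNorm_two_sq_eq_lintegral, MemLp, ENNReal.pow_lt_top_iff]
  simp [hf]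

/-- Bounded sequences in separable Hilbert spaces have weakly convergent subsequences. -/
theorem exists_subseq_tendsto_inner {H : Type*} [NormedAddCommGroup H] [InnerProductSpace ℝ H]
    [CompleteSpace H] [TopologicalSpace.SeparableSpace H] (u : ℕ → H) {C : ℝ}
    (hu : ∀ n, ‖u n‖ ≤ C) :
    ∃ (v : H) (φ : ℕ → ℕ), StrictMono φ ∧
      ∀ w, Tendsto (fun n => ⟪u (φ n), w⟫) atTop (nhds ⟪v, w⟫) := by
  have hcpt := WeakDual.isSeqCompact_closedBall (𝕜 := ℝ) (E := H) 0 C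
  obtain ⟨L, -, φ, hφ, hL⟩ := hcpt
    (x := fun n => StrongDual.toWeakDual (InnerProductSpace.toDual ℝ H (u n)))
    (fun n => by simpa using hu n)
  refine ⟨(InnerProductSpace.toDual ℝ H).symm (WeakDual.toStrongDual L), φ, hφ, fun w => ?_⟩
  have h := ((WeakDual.eval_continuous (𝕜 := ℝ) w).tendsto L).comp hL
  rw [InnerProductSpace.toDual_symm_apply]
  exact h

theorem exists_subseq_tendsto_integral_inner [InnerProductSpace ℝ F] [CompleteSpace F]
    [TopologicalSpace.SeparableSpace F] [IsSeparable μ] (u : ℕ → α → F)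
    (hu : ∀ n, AEStronglyMeasurable (u n) μ) {C : ℝ≥0∞} (hC : C ≠ ∞)
    (hb : ∀ n, ∫⁻ x, ‖u n x‖ₑ ^ 2 ∂μ ≤ C) :
    ∃ (v : α → F) (φ : ℕ → ℕ), MemLp v 2 μ ∧ StrictMono φ ∧ ∀ w : α → F, MemLp w 2 μ →
      Tendsto (fun n => ∫ x, ⟪u (φ n) x, w x⟫ ∂μ) atTop (nhds (∫ x, ⟪v x, w x⟫ ∂μ)) := by
  have : Fact ((2 : ℝ≥0∞) ≠ ∞) := ⟨by simp⟩
  have hL : ∀ n, MemLp (u n) 2 μ := fun n =>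
    (memLp_two_iff_lintegral_lt_top (hu n)).2 ((hb n).trans_lt hC.lt_top)
  have hinner : ∀ {a b : α → F} (ha : MemLp a 2 μ) (hb : MemLp b 2 μ),
      ⟪ha.toLp a, hb.toLp b⟫ = ∫ x, ⟪a x, b x⟫ ∂μ := by
    intro a b ha hb
    rw [L2.inner_def]
    refine integral_congr_ae ?_
    filter_upwards [ha.coeFn_toLp, hb.coeFn_toLp] with x h1 h2
    rw [h1, h2]
  obtain ⟨v, φ, hφ, hv⟩ := exists_subseq_tendsto_inner (fun n => (hL n).toLp (u n))
    (C := Real.sqrt C.toReal) (fun n => by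
      rw [Lp.norm_toLp]
      refine Real.le_sqrt_of_sq_le ?_
      rw [← ENNReal.toReal_pow, eLpNorm_two_sq_eq_lintegral]
      exact ENNReal.toReal_mono hC (hb n))
  refine ⟨v, φ, Lp.memLp v, hφ, fun w hw => ?_⟩
  have h := hv (hw.toLp w)
  simp only [hinner] at h
  have h2 := hinner (Lp.memLp v) hw
  rw [Lp.toLp_coeFn] at h2
  rwa [h2] at h

end WeakCompactness

section Poincare

variable {E : Type*} [NormedAddCommGroup E] [InnerProductSpace ℝ E] [FiniteDimensional ℝ E]
  [MeasurableSpace E] [BorelSpace E]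

theorem memLp_one_add_norm_sq : MemLp (fun x : E => 1 + ‖x‖ ^ 2) 2 (gaussWeight E) :=
  (memLp_two_iff_lintegral_lt_top (by fun_prop)).2 lintegral_sq_gaussWeight_lt_top

theorem aemeasurable_enorm_sub_prodRotation_sq {f : E → ℝ}
    (hf : AEStronglyMeasurable f (gaussWeight E)) (t : ℝ) :
    AEMeasurable (fun p : E × E => ‖f p.1 - f (prodRotation t p).1‖ₑ ^ 2)
      ((gaussWeight E).prod (gaussWeight E)) := by
  have hq : Measure.QuasiMeasurePreserving (Prod.fst : E × E → E)
      ((gaussWeight E).prod (gaussWeight E)) (gaussWeight E) :=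
    Measure.quasiMeasurePreserving_fst
  exact ((hf.comp_quasiMeasurePreserving hq).sub (hf.comp_quasiMeasurePreserving
    (hq.comp (measurePreserving_prodRotation t).quasiMeasurePreserving))).enorm.pow_const 2

/-- A Poincaré inequality for the Gaussian weight. -/
theorem exists_lintegral_sq_le (N : ℕ) :
    ∃ C : ℝ≥0∞, C ≠ ∞ ∧ ∀ (f : EuclideanSpace ℝ (Fin N) → ℝ)
      (g : EuclideanSpace ℝ (Fin N) → EuclideanSpace ℝ (Fin N)), HasWeakGradient N f g →
      Integrable (fun x => (1 + ‖x‖ ^ 2) * f x) (gaussWeight _) →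
      ∫ x, (1 + ‖x‖ ^ 2) * f x ∂gaussWeight _ = 0 →
      ∫⁻ x, ‖f x‖ₑ ^ 2 ∂gaussWeight _ ≤ C * ∫⁻ x, ‖g x‖ₑ ^ 2 ∂gaussWeight _ := by
  set γ := gaussWeight (EuclideanSpace ℝ (Fin N)) with hγ
  set m := ∫⁻ y : EuclideanSpace ℝ (Fin N), ‖y‖ₑ ^ 2 ∂γ with hm
  set M := ∫⁻ y : EuclideanSpace ℝ (Fin N), ‖1 + ‖y‖ ^ 2‖ₑ ^ 2 ∂γ with hM
  set W := ∫ y : EuclideanSpace ℝ (Fin N), (1 + ‖y‖ ^ 2) ∂γ with hW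
  have hwi : Integrable (fun x : EuclideanSpace ℝ (Fin N) => 1 + ‖x‖ ^ 2) γ :=
    memLp_one_add_norm_sq.integrable one_le_two
  have hWpos : 0 < W := by
    rw [hW, integral_pos_iff_support_of_nonneg (fun x => by positivity) hwi]
    have : Function.support (fun x : EuclideanSpace ℝ (Fin N) => 1 + ‖x‖ ^ 2) = Set.univ := by
      ext x
      simp only [Function.mem_support, Set.mem_univ, iff_true]
      positivity
    rw [this]
    exact NeZero.pos _
  have hW0 : ‖W‖ₑ ^ 2 ≠ 0 := by simp [hWpos.ne']
  have hWt : ‖W‖ₑ ^ 2 ≠ ∞ := by simp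
  refine ⟨(‖W‖ₑ ^ 2)⁻¹ * (ENNReal.ofReal (Real.pi / 2) ^ 2 *
    (ENNReal.ofReal (Real.exp (3 / 2)) * m) * M), ?_, ?_⟩
  · have h1 : m ≠ ∞ := lintegral_norm_sq_gaussWeight_lt_top.ne
    have h2 : M ≠ ∞ := lintegral_sq_gaussWeight_lt_top.ne
    finiteness
  intro f g h hi h0
  have hfm : AEStronglyMeasurable f γ :=
    h.1.aestronglyMeasurable.mono_ac gaussWeight_absolutelyContinuous
  have hpt : ∀ x, ‖W‖ₑ ^ 2 * ‖f x‖ₑ ^ 2 ≤ (∫⁻ y, ‖f x - f y‖ₑ ^ 2 ∂γ) * M := by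
    intro x
    have h1 : W * f x = ∫ y, (f x - f y) * (1 + ‖y‖ ^ 2) ∂γ := by
      have : ∀ y, (f x - f y) * (1 + ‖y‖ ^ 2) = (1 + ‖y‖ ^ 2) * f x - (1 + ‖y‖ ^ 2) * f y :=
        fun y => by ring
      simp only [this]
      rw [integral_sub (hwi.mul_const _) hi, h0, integral_mul_const, sub_zero]
    rw [← mul_pow, ← enorm_mul, h1]
    refine le_trans ?_ (lintegral_mul_sq_le (f := fun y => ‖f x - f y‖ₑ)
      (g := fun y => ‖1 + ‖y‖ ^ 2‖ₑ) ((aestronglyMeasurable_const.sub hfm).enorm)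
      (by fun_prop))
    gcongr
    refine (enorm_integral_le_lintegral_enorm _).trans_eq ?_
    simp only [enorm_mul]
  have hrot := lintegral_sub_prodRotation_le h (t := Real.pi / 2) (by positivity)
  rw [lintegral_prod _ (aemeasurable_enorm_sub_prodRotation_sq hfm _)] at hrot
  simp only [prodRotation_apply, Real.cos_pi_div_two, Real.sin_pi_div_two, zero_smul, one_smul,
    zero_add] at hrot
  have hMt : M ≠ ∞ := lintegral_sq_gaussWeight_lt_top.ne
  rw [mul_assoc, ← ENNReal.mul_le_iff_le_inv hW0 hWt, ← lintegral_const_mul' _ _ hWt]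
  calc _ ≤ ∫⁻ x, (∫⁻ y, ‖f x - f y‖ₑ ^ 2 ∂γ) * M ∂γ := lintegral_mono hpt
    _ = (∫⁻ x, (∫⁻ y, ‖f x - f y‖ₑ ^ 2 ∂γ) ∂γ) * M := lintegral_mul_const' _ _ hMt
    _ ≤ _ := by
      refine (mul_le_mul_left hrot M).trans_eq ?_
      ring

end Poincare

section Mehler

variable {E : Type*} [NormedAddCommGroup E] [InnerProductSpace ℝ E] [FiniteDimensional ℝ E]
  [MeasurableSpace E] [BorelSpace E]

/-- The unnormalised Mehler kernel with respect to `gaussWeight`. -/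
def mehlerKernel (c s : ℝ) (x z : E) : ℝ :=
  Real.exp (‖z‖ ^ 2 / 2 - ‖z - c • x‖ ^ 2 / (2 * s ^ 2))

theorem continuous_mehlerKernel (c s : ℝ) (x : E) : Continuous (mehlerKernel c s x) := by
  unfold mehlerKernel
  fun_prop

theorem integral_comp_add_smul_gaussWeight (h : E → ℝ) (c : ℝ) {s : ℝ} (hs : 0 < s) (x : E) :
    ∫ y, h (c • x + s • y) ∂gaussWeight E =
      |(s ^ Module.finrank ℝ E)⁻¹| * ∫ z, h z * mehlerKernel c s x z ∂gaussWeight E := by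
  rw [integral_gaussWeight, integral_gaussWeight]
  set F : E → ℝ := fun z => Real.exp (-‖z - c • x‖ ^ 2 / (2 * s ^ 2)) * h z with hF
  have h1 : ∀ y : E, Real.exp (-‖y‖ ^ 2 / 2) • h (c • x + s • y) = F (c • x + s • y) := by
    intro y
    simp only [hF, add_sub_cancel_left, norm_smul, smul_eq_mul, mul_pow, Real.norm_eq_abs, sq_abs]
    congr 2
    field_simp
  have h2 : ∀ z : E, Real.exp (-‖z‖ ^ 2 / 2) • (h z * mehlerKernel c s x z) = F z := by
    intro z
    simp only [hF, mehlerKernel, smul_eq_mul]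
    rw [mul_left_comm, ← Real.exp_add, mul_comm]
    congr 2
    ring
  simp only [h1, h2]
  rw [Measure.integral_comp_smul volume (fun w => F (c • x + w)) s, smul_eq_mul,
    integral_add_left_eq_self]

theorem norm_sq_le_of_sq_add_sq_eq_one {c s : ℝ} (hcs : c ^ 2 + s ^ 2 = 1) (hs : 0 < s)
    (x z : E) :
    ‖z‖ ^ 2 ≤ (1 - s ^ 2 / 4) * ‖x‖ ^ 2 + 4 / 3 * ((1 - s ^ 2 / 4) * ‖z - c • x‖ ^ 2 / s ^ 2) := by
  set w := z - c • x with hw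
  have hz : ‖z‖ ≤ |c| * ‖x‖ + ‖w‖ := by
    have : z = c • x + w := by rw [hw]; abel
    calc ‖z‖ = ‖c • x + w‖ := by rw [← this]
      _ ≤ _ := (norm_add_le _ _).trans_eq (by rw [norm_smul, Real.norm_eq_abs])
  have h2 : ‖z‖ ^ 2 ≤ (|c| * ‖x‖ + ‖w‖) ^ 2 := by gcongr
  refine h2.trans ?_
  set b := ‖w‖ / s with hb
  have hwb : ‖w‖ = s * b := by rw [hb]; field_simp
  have hws : (1 - s ^ 2 / 4) * ‖w‖ ^ 2 / s ^ 2 = (1 - s ^ 2 / 4) * b ^ 2 := by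
    rw [hwb]; field_simp
  rw [hws, hwb]
  have hc2 : |c| ^ 2 = 1 - s ^ 2 := by rw [sq_abs]; linarith
  have key : (1 - s ^ 2 / 4) * ‖x‖ ^ 2 + 4 / 3 * ((1 - s ^ 2 / 4) * b ^ 2)
      - (|c| * ‖x‖ + s * b) ^ 2 = 3 / 4 * (s * ‖x‖ - 4 / 3 * |c| * b) ^ 2 := by
    linear_combination (-‖x‖ ^ 2 - 4 / 3 * b ^ 2) * hc2
  nlinarith [sq_nonneg (s * ‖x‖ - 4 / 3 * |c| * b)]

theorem mehlerKernel_sq_mul_exp_le {c s : ℝ} (hcs : c ^ 2 + s ^ 2 = 1) (hs : 0 < s) (x z : E) :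
    Real.exp (-‖z‖ ^ 2 / 2) * mehlerKernel c s x z ^ 2 ≤
      Real.exp ((1 - s ^ 2 / 4) / 2 * ‖x‖ ^ 2) * Real.exp (-(1 / (3 * s ^ 2)) * ‖z - c • x‖ ^ 2) := by
  rw [mehlerKernel, ← Real.exp_nat_mul, ← Real.exp_add, ← Real.exp_add]
  refine Real.exp_le_exp.2 ?_
  have h := norm_sq_le_of_sq_add_sq_eq_one hcs hs x z
  set a := ‖z - c • x‖ ^ 2 / s ^ 2 with ha
  have ha0 : 0 ≤ a := by positivity
  have e1 : ‖z - c • x‖ ^ 2 / (2 * s ^ 2) = a / 2 := by rw [ha]; ring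
  have e2 : -(1 / (3 * s ^ 2)) * ‖z - c • x‖ ^ 2 = - a / 3 := by rw [ha]; ring
  have e3 : (1 - s ^ 2 / 4) * ‖z - c • x‖ ^ 2 / s ^ 2 = (1 - s ^ 2 / 4) * a := by rw [ha]; ring
  rw [e1, e2]
  rw [e3] at h
  push_cast
  nlinarith [mul_nonneg (sq_nonneg s) ha0]

theorem lintegral_mehlerKernel_sq_le {c s : ℝ} (hcs : c ^ 2 + s ^ 2 = 1) (hs : 0 < s) (x : E) :
    ∫⁻ z, ‖mehlerKernel c s x z‖ₑ ^ 2 ∂gaussWeight E ≤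
      ENNReal.ofReal (Real.exp ((1 - s ^ 2 / 4) / 2 * ‖x‖ ^ 2)) *
        ∫⁻ w : E, ENNReal.ofReal (Real.exp (-(1 / (3 * s ^ 2)) * ‖w‖ ^ 2)) := by
  rw [lintegral_gaussWeight, ← lintegral_sub_right_eq_self
    (fun w : E => ENNReal.ofReal (Real.exp (-(1 / (3 * s ^ 2)) * ‖w‖ ^ 2))) (c • x),
    ← lintegral_const_mul' _ _ ENNReal.ofReal_ne_top]
  refine lintegral_mono fun z => ?_
  rw [mehlerKernel, Real.enorm_eq_ofReal (Real.exp_pos _).le, ← ENNReal.ofReal_pow (Real.exp_pos _).le,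
    ← ENNReal.ofReal_mul (Real.exp_pos _).le, ← ENNReal.ofReal_mul (Real.exp_pos _).le]
  exact ENNReal.ofReal_le_ofReal (mehlerKernel_sq_mul_exp_le hcs hs x z)

theorem lintegral_exp_neg_mul_norm_sq_lt_top {b : ℝ} (hb : 0 < b) :
    ∫⁻ w : E, ENNReal.ofReal (Real.exp (-b * ‖w‖ ^ 2)) < ∞ :=
  (integrable_exp_neg_mul_norm_sq hb).lintegral_lt_top

theorem memLp_mehlerKernel {c s : ℝ} (hcs : c ^ 2 + s ^ 2 = 1) (hs : 0 < s) (x : E) :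
    MemLp (mehlerKernel c s x) 2 (gaussWeight E) :=
  (memLp_two_iff_lintegral_lt_top (continuous_mehlerKernel c s x).aestronglyMeasurable).2
    ((lintegral_mehlerKernel_sq_le hcs hs x).trans_lt (ENNReal.mul_lt_top ENNReal.ofReal_lt_top
      (lintegral_exp_neg_mul_norm_sq_lt_top (by positivity))))

/-- The Mehler semigroup maps weakly null sequences to strongly null sequences. -/
theorem tendsto_lintegral_sq_integral_prodRotation {h : ℕ → E → ℝ}
    (hm : ∀ n, AEStronglyMeasurable (h n) (gaussWeight E)) {M : ℝ≥0∞} (hM : M ≠ ∞)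
    (hb : ∀ n, ∫⁻ x, ‖h n x‖ₑ ^ 2 ∂gaussWeight E ≤ M)
    (hw : ∀ w : E → ℝ, MemLp w 2 (gaussWeight E) →
      Tendsto (fun n => ∫ x, h n x * w x ∂gaussWeight E) atTop (nhds 0))
    {t : ℝ} (ht : 0 < Real.sin t) :
    Tendsto (fun n => ∫⁻ x, ‖∫ y, h n (prodRotation t (x, y)).1 ∂gaussWeight E‖ₑ ^ 2
      ∂gaussWeight E) atTop (nhds 0) := by
  have hcs : Real.cos t ^ 2 + Real.sin t ^ 2 = 1 := Real.cos_sq_add_sin_sq t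
  set A := ‖|(Real.sin t ^ Module.finrank ℝ E)⁻¹|‖ₑ with hA
  set K := ∫⁻ w : E, ENNReal.ofReal (Real.exp (-(1 / (3 * Real.sin t ^ 2)) * ‖w‖ ^ 2)) with hK
  have hKt : K ≠ ∞ := (lintegral_exp_neg_mul_norm_sq_lt_top (by positivity)).ne
  have hrep : ∀ n x, ∫ y, h n (prodRotation t (x, y)).1 ∂gaussWeight E =
      |(Real.sin t ^ Module.finrank ℝ E)⁻¹| *
        ∫ z, h n z * mehlerKernel (Real.cos t) (Real.sin t) x z ∂gaussWeight E := fun n x => by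
    simp only [prodRotation_apply]
    exact integral_comp_add_smul_gaussWeight (h n) _ ht x
  have hlim : ∀ x : E, Tendsto (fun n => ‖∫ y, h n (prodRotation t (x, y)).1 ∂gaussWeight E‖ₑ ^ 2)
      atTop (nhds 0) := by
    intro x
    simp only [hrep]
    have h1 := (hw _ (memLp_mehlerKernel hcs ht x)).const_mul
      |(Real.sin t ^ Module.finrank ℝ E)⁻¹|
    rw [mul_zero] at h1
    have h2 := ((ENNReal.continuous_pow 2).tendsto _).comp ((continuous_enorm.tendsto _).comp h1)
    simpa [Function.comp_def] using! h2
  have h0 := tendsto_lintegral_of_dominated_convergence' (μ := gaussWeight E)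
    (F := fun n x => ‖∫ y, h n (prodRotation t (x, y)).1 ∂gaussWeight E‖ₑ ^ 2) (f := fun _ => 0)
    (fun x => A ^ 2 * (M * (ENNReal.ofReal
      (Real.exp ((1 - Real.sin t ^ 2 / 4) / 2 * ‖x‖ ^ 2)) * K))) ?_ ?_ ?_
      (Eventually.of_forall hlim)
  · simpa using h0
  · intro n
    have hq : Measure.QuasiMeasurePreserving (Prod.fst : E × E → E)
        ((gaussWeight E).prod (gaussWeight E)) (gaussWeight E) :=
      Measure.quasiMeasurePreserving_fst
    exact ((hm n).comp_quasiMeasurePreserving (hq.comp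
      (measurePreserving_prodRotation t).quasiMeasurePreserving)).integral_prod_right'.enorm.pow_const 2
  · intro n
    refine Eventually.of_forall fun x => ?_
    simp only [hrep, enorm_mul, mul_pow]
    refine mul_le_mul_right ?_ (A ^ 2)
    calc _ ≤ (∫⁻ z, ‖h n z‖ₑ * ‖mehlerKernel (Real.cos t) (Real.sin t) x z‖ₑ ∂gaussWeight E) ^ 2 := by
          gcongr
          refine (enorm_integral_le_lintegral_enorm _).trans_eq ?_
          simp only [enorm_mul]
      _ ≤ _ := lintegral_mul_sq_le (hm n).enorm
          (continuous_mehlerKernel _ _ x).aestronglyMeasurable.enorm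
      _ ≤ _ := mul_le_mul' (hb n) (lintegral_mehlerKernel_sq_le hcs ht x)
  · have hs1 : (1 - Real.sin t ^ 2 / 4) / 2 < 1 / 2 := by
      have : 0 < Real.sin t ^ 2 := by positivity
      linarith
    have hA2 : A ^ 2 ≠ ∞ := by simp [hA]
    rw [lintegral_const_mul' _ _ hA2, lintegral_const_mul' _ _ hM, lintegral_mul_const' _ _ hKt]
    exact ENNReal.mul_ne_top hA2 (ENNReal.mul_ne_top hM (ENNReal.mul_ne_top
      (lintegral_exp_gaussWeight_lt_top hs1).ne hKt))

end Mehler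

section Compactness

theorem ENNReal.add_sq_le_four_mul (a b : ℝ≥0∞) : (a + b) ^ 2 ≤ 4 * (a ^ 2 + b ^ 2) := by
  have h : ∀ {a b : ℝ≥0∞}, a ≤ b → (a + b) ^ 2 ≤ 4 * (a ^ 2 + b ^ 2) := fun {a b} hab =>
    calc (a + b) ^ 2 ≤ (b + b) ^ 2 := by gcongr
      _ = 4 * b ^ 2 := by ring
      _ ≤ _ := by gcongr; exact le_add_self
  rcases le_total a b with hab | hab
  · exact h hab
  · rw [add_comm a, add_comm (a ^ 2)]
    exact h hab

variable {E : Type*} [NormedAddCommGroup E] [InnerProductSpace ℝ E] [FiniteDimensional ℝ E]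
  [MeasurableSpace E] [BorelSpace E]

theorem lintegral_sq_le_add_lintegral_prodRotation {h : E → ℝ} (hh : MemLp h 2 (gaussWeight E))
    (t : ℝ) :
    gaussWeight E Set.univ ^ 2 * ∫⁻ x, ‖h x‖ₑ ^ 2 ∂gaussWeight E ≤
      4 * (gaussWeight E Set.univ * (∫⁻ p, ‖h p.1 - h (prodRotation t p).1‖ₑ ^ 2
          ∂(gaussWeight E).prod (gaussWeight E)) +
        ∫⁻ x, ‖∫ y, h (prodRotation t (x, y)).1 ∂gaussWeight E‖ₑ ^ 2 ∂gaussWeight E) := by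
  set γ := gaussWeight E with hγ
  have hΓ : γ Set.univ ≠ ∞ := measure_ne_top _ _
  have hint : Integrable (fun p : E × E => h (prodRotation t p).1) (γ.prod γ) :=
    (measurePreserving_prodRotation t).integrable_comp_of_integrable
      ((hh.integrable one_le_two).comp_fst γ)
  have hpt : ∀ᵐ x ∂γ, γ Set.univ ^ 2 * ‖h x‖ₑ ^ 2 ≤
      4 * (γ Set.univ * (∫⁻ y, ‖h x - h (prodRotation t (x, y)).1‖ₑ ^ 2 ∂γ) +
        ‖∫ y, h (prodRotation t (x, y)).1 ∂γ‖ₑ ^ 2) := by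
    filter_upwards [hint.prod_right_ae] with x hx
    have h1 : γ.real Set.univ * h x = (∫ y, (h x - h (prodRotation t (x, y)).1) ∂γ) +
        ∫ y, h (prodRotation t (x, y)).1 ∂γ := by
      rw [integral_sub (integrable_const _) hx, integral_const, smul_eq_mul]
      ring
    have h2 : γ Set.univ = ‖γ.real Set.univ‖ₑ := by
      rw [Real.enorm_eq_ofReal measureReal_nonneg, ofReal_measureReal]
    have h3 : γ Set.univ ^ 2 * ‖h x‖ₑ ^ 2 = ‖γ.real Set.univ * h x‖ₑ ^ 2 := by
      rw [enorm_mul, mul_pow, ← h2]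
    rw [h3, h1]
    refine (pow_le_pow_left' (enorm_add_le _ _) 2).trans
      ((ENNReal.add_sq_le_four_mul _ _).trans ?_)
    gcongr
    refine (pow_le_pow_left' (enorm_integral_le_lintegral_enorm _) 2).trans ?_
    have h4 := lintegral_mul_sq_le (μ := γ) (f := fun _ => 1)
      (g := fun y => ‖h x - h (prodRotation t (x, y)).1‖ₑ) aemeasurable_const
      (aestronglyMeasurable_const.sub hx.aestronglyMeasurable).enorm
    simpa using h4
  have hm := aemeasurable_enorm_sub_prodRotation_sq hh.aestronglyMeasurable t
  rw [lintegral_prod _ hm, ← lintegral_const_mul' _ _ (ENNReal.pow_ne_top hΓ)]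
  refine (lintegral_mono_ae hpt).trans_eq ?_
  rw [lintegral_const_mul' _ _ (by simp), lintegral_add_left' (hm.lintegral_prod_right'.const_mul _),
    lintegral_const_mul' _ _ hΓ]

/-- A weakly null sequence of functions with bounded Dirichlet energy is strongly null. -/
theorem tendsto_lintegral_sq_of_weakly_null {N : ℕ} {h : ℕ → EuclideanSpace ℝ (Fin N) → ℝ}
    {G : ℕ → EuclideanSpace ℝ (Fin N) → EuclideanSpace ℝ (Fin N)}
    (hG : ∀ n, HasWeakGradient N (h n) (G n)) {M D : ℝ≥0∞} (hM : M ≠ ∞) (hD : D ≠ ∞)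
    (hb : ∀ n, ∫⁻ x, ‖h n x‖ₑ ^ 2 ∂gaussWeight _ ≤ M)
    (hGb : ∀ n, ∫⁻ x, ‖G n x‖ₑ ^ 2 ∂gaussWeight _ ≤ D)
    (hw : ∀ w : EuclideanSpace ℝ (Fin N) → ℝ, MemLp w 2 (gaussWeight _) →
      Tendsto (fun n => ∫ x, h n x * w x ∂gaussWeight _) atTop (nhds 0)) :
    Tendsto (fun n => ∫⁻ x, ‖h n x‖ₑ ^ 2 ∂gaussWeight _) atTop (nhds 0) := by
  set γ := gaussWeight (EuclideanSpace ℝ (Fin N)) with hγ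
  have hm : ∀ n, AEStronglyMeasurable (h n) γ := fun n =>
    (hG n).1.aestronglyMeasurable.mono_ac gaussWeight_absolutelyContinuous
  have hL : ∀ n, MemLp (h n) 2 γ := fun n =>
    (memLp_two_iff_lintegral_lt_top (hm n)).2 ((hb n).trans_lt hM.lt_top)
  have hΓt : γ Set.univ ^ 2 ≠ ∞ := by finiteness
  have hΓ0 : γ Set.univ ^ 2 ≠ 0 := pow_ne_zero _ (NeZero.ne _)
  set m := ∫⁻ y : EuclideanSpace ℝ (Fin N), ‖y‖ₑ ^ 2 ∂γ with hmdef
  have hmt : m ≠ ∞ := lintegral_norm_sq_gaussWeight_lt_top.ne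
  set K := γ Set.univ * (ENNReal.ofReal (Real.exp (3 / 2)) * D * m) with hK
  have hKt : K ≠ ∞ := by finiteness
  have hest : ∀ t, 0 ≤ t → ∀ n, γ Set.univ ^ 2 * ∫⁻ x, ‖h n x‖ₑ ^ 2 ∂γ ≤
      4 * (K * ENNReal.ofReal t ^ 2 +
        ∫⁻ x, ‖∫ y, h n (prodRotation t (x, y)).1 ∂γ‖ₑ ^ 2 ∂γ) := by
    intro t ht n
    refine (lintegral_sq_le_add_lintegral_prodRotation (hL n) t).trans ?_
    gcongr 4 * (?_ + _)
    calc _ ≤ γ Set.univ * (ENNReal.ofReal t ^ 2 * (ENNReal.ofReal (Real.exp (3 / 2)) * D * m)) := by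
          refine mul_le_mul_right ((lintegral_sub_prodRotation_le (hG n) ht).trans ?_) _
          gcongr
          exact hGb n
      _ = _ := by rw [hK]; ring
  have hlim : Tendsto (fun n => γ Set.univ ^ 2 * ∫⁻ x, ‖h n x‖ₑ ^ 2 ∂γ) atTop (nhds 0) := by
    rw [ENNReal.tendsto_nhds_zero]
    intro ε hε
    have hε8 : 0 < ε / 8 := ENNReal.div_pos hε.ne' (by simp)
    have h1 : Tendsto (fun n : ℕ => K * ENNReal.ofReal (1 / ((n : ℝ) + 1)) ^ 2) atTop
        (nhds 0) := by
      have h2 := ((ENNReal.continuous_pow 2).tendsto _).comp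
        (ENNReal.tendsto_ofReal tendsto_one_div_add_atTop_nhds_zero_nat)
      have h3 := ENNReal.Tendsto.const_mul h2 (Or.inr hKt)
      simpa [Function.comp_def] using! h3
    obtain ⟨k, hk⟩ := (ENNReal.tendsto_nhds_zero.1 h1 _ hε8).exists
    set t := 1 / ((k : ℝ) + 1) with ht
    have ht0 : 0 < t := by positivity
    have ht1 : t ≤ 1 := by
      rw [ht, div_le_one (by positivity)]
      exact le_add_of_nonneg_left (Nat.cast_nonneg k)
    have h4 := tendsto_lintegral_sq_integral_prodRotation hm hM hb hw
      (Real.sin_pos_of_pos_of_le_one ht0 ht1)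
    filter_upwards [ENNReal.tendsto_nhds_zero.1 h4 _ hε8] with n hn
    calc _ ≤ _ := hest t ht0.le n
      _ ≤ 4 * (ε / 8 + ε / 8) := by gcongr
      _ = 8 * (ε / 8) := by ring
      _ = ε := ENNReal.mul_div_cancel (by simp) (by simp)
  have h5 := ENNReal.Tendsto.const_mul (a := (γ Set.univ ^ 2)⁻¹) hlim
    (Or.inr (ENNReal.inv_ne_top.2 hΓ0))
  simpa only [← mul_assoc, ENNReal.inv_mul_cancel hΓ0 hΓt, one_mul, mul_zero] using h5

end Compactness

section WeakGradient

variable {E : Type*} [NormedAddCommGroup E] [InnerProductSpace ℝ E] [FiniteDimensional ℝ E]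
  [MeasurableSpace E] [BorelSpace E]

theorem locallyIntegrable_of_memLp_gaussWeight {F : Type*} [NormedAddCommGroup F]
    [NormedSpace ℝ F] {f : E → F} (hf : MemLp f 2 (gaussWeight E)) :
    LocallyIntegrable f volume := by
  have h1 := (integrable_gaussWeight_iff.1 (hf.integrable one_le_two)).locallyIntegrable
  have h2 := h1.continuous_smul (g := fun x : E => Real.exp (‖x‖ ^ 2 / 2)) (by fun_prop)
  refine h2.congr (Eventually.of_forall fun x => ?_)
  simp only [smul_smul, ← Real.exp_add]
  rw [show ‖x‖ ^ 2 / 2 + -‖x‖ ^ 2 / 2 = 0 by ring, Real.exp_zero, one_smul]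

theorem integral_mul_exp_mul_gaussWeight (u a : E → ℝ) :
    ∫ x, u x * (Real.exp (‖x‖ ^ 2 / 2) * a x) ∂gaussWeight E = ∫ x, u x * a x := by
  rw [integral_gaussWeight]
  refine integral_congr_ae (Eventually.of_forall fun x => ?_)
  simp only [smul_eq_mul]
  rw [show Real.exp (-‖x‖ ^ 2 / 2) * (u x * (Real.exp (‖x‖ ^ 2 / 2) * a x)) =
    Real.exp (-‖x‖ ^ 2 / 2) * Real.exp (‖x‖ ^ 2 / 2) * (u x * a x) by ring, ← Real.exp_add,
    show -‖x‖ ^ 2 / 2 + ‖x‖ ^ 2 / 2 = 0 by ring, Real.exp_zero, one_mul]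

variable {N : ℕ}

theorem integrable_mul_fderiv_single {f : EuclideanSpace ℝ (Fin N) → ℝ}
    (hf : LocallyIntegrable f volume) {φ : EuclideanSpace ℝ (Fin N) → ℝ}
    (hφ : ContDiff ℝ (⊤ : ℕ∞) φ) (hc : HasCompactSupport φ) (v : EuclideanSpace ℝ (Fin N)) :
    Integrable (fun x => f x * fderiv ℝ φ x v) :=
  hf.integrable_smul_right_of_hasCompactSupport
    ((hφ.continuous_fderiv (by simp)).clm_apply continuous_const) (hc.fderiv_apply ℝ v)

theorem integrable_apply_mul {g : EuclideanSpace ℝ (Fin N) → EuclideanSpace ℝ (Fin N)}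
    (hg : LocallyIntegrable g volume) {φ : EuclideanSpace ℝ (Fin N) → ℝ}
    (hφ : ContDiff ℝ (⊤ : ℕ∞) φ) (hc : HasCompactSupport φ) (i : Fin N) :
    Integrable (fun x => g x i * φ x) := by
  have h := (hg.integrable_smul_left_of_hasCompactSupport hφ.continuous hc)
  have h2 := (EuclideanSpace.proj i : EuclideanSpace ℝ (Fin N) →L[ℝ] ℝ).integrable_comp h
  refine h2.congr (Eventually.of_forall fun x => ?_)
  simp [mul_comm]

theorem HasWeakGradient.sub {f₁ f₂ : EuclideanSpace ℝ (Fin N) → ℝ}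
    {g₁ g₂ : EuclideanSpace ℝ (Fin N) → EuclideanSpace ℝ (Fin N)}
    (h₁ : HasWeakGradient N f₁ g₁) (h₂ : HasWeakGradient N f₂ g₂) :
    HasWeakGradient N (fun x => f₁ x - f₂ x) (fun x => g₁ x - g₂ x) := by
  refine ⟨h₁.1.sub h₂.1, h₁.2.1.sub h₂.2.1, fun i φ hφ hc => ?_⟩
  simp only [sub_mul, PiLp.sub_apply]
  rw [integral_sub (integrable_mul_fderiv_single h₁.1 hφ hc _)
      (integrable_mul_fderiv_single h₂.1 hφ hc _),
    integral_sub (integrable_apply_mul h₁.2.1 hφ hc i) (integrable_apply_mul h₂.2.1 hφ hc i),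
    h₁.2.2 i φ hφ hc, h₂.2.2 i φ hφ hc]
  ring

/-- Weak gradients pass to weak limits. -/
theorem hasWeakGradient_of_tendsto {f : ℕ → EuclideanSpace ℝ (Fin N) → ℝ}
    {g : ℕ → EuclideanSpace ℝ (Fin N) → EuclideanSpace ℝ (Fin N)}
    (hfg : ∀ n, HasWeakGradient N (f n) (g n)) {f' : EuclideanSpace ℝ (Fin N) → ℝ}
    {g' : EuclideanSpace ℝ (Fin N) → EuclideanSpace ℝ (Fin N)}
    (hf' : MemLp f' 2 (gaussWeight _)) (hg' : MemLp g' 2 (gaussWeight _))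
    (hf : ∀ w : EuclideanSpace ℝ (Fin N) → ℝ, MemLp w 2 (gaussWeight _) →
      Tendsto (fun n => ∫ x, f n x * w x ∂gaussWeight _) atTop
        (nhds (∫ x, f' x * w x ∂gaussWeight _)))
    (hg : ∀ w : EuclideanSpace ℝ (Fin N) → EuclideanSpace ℝ (Fin N),
      MemLp w 2 (gaussWeight _) →
      Tendsto (fun n => ∫ x, ⟪g n x, w x⟫ ∂gaussWeight _) atTop
        (nhds (∫ x, ⟪g' x, w x⟫ ∂gaussWeight _))) :
    HasWeakGradient N f' g' := by
  refine ⟨locallyIntegrable_of_memLp_gaussWeight hf', locallyIntegrable_of_memLp_gaussWeight hg',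
    fun i φ hφ hc => ?_⟩
  have hexp : Continuous fun x : EuclideanSpace ℝ (Fin N) => Real.exp (‖x‖ ^ 2 / 2) := by fun_prop
  have h1 := hf (fun x => Real.exp (‖x‖ ^ 2 / 2) * fderiv ℝ φ x (EuclideanSpace.single i 1))
    (Continuous.memLp_of_hasCompactSupport
      (hexp.mul ((hφ.continuous_fderiv (by simp)).clm_apply continuous_const))
      ((hc.fderiv_apply ℝ _).mul_left))
  have h2 := hg (fun x => (Real.exp (‖x‖ ^ 2 / 2) * φ x) • EuclideanSpace.single i 1)
    (Continuous.memLp_of_hasCompactSupport ((hexp.mul hφ.continuous).smul continuous_const)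
      (hc.mul_left.smul_right))
  have h3 : ∀ (u : EuclideanSpace ℝ (Fin N) → EuclideanSpace ℝ (Fin N)) x,
      ⟪u x, (Real.exp (‖x‖ ^ 2 / 2) * φ x) • EuclideanSpace.single i (1 : ℝ)⟫ =
        u x i * (Real.exp (‖x‖ ^ 2 / 2) * φ x) := by
    intro u x
    rw [inner_smul_right, EuclideanSpace.inner_single_right]
    simp [mul_comm]
  simp only [h3] at h2
  have h4 : ∀ u : EuclideanSpace ℝ (Fin N) → EuclideanSpace ℝ (Fin N),
      ∫ x, u x i * (Real.exp (‖x‖ ^ 2 / 2) * φ x) ∂gaussWeight _ = ∫ x, u x i * φ x :=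
    fun u => integral_mul_exp_mul_gaussWeight (fun x => u x i) φ
  simp only [integral_mul_exp_mul_gaussWeight] at h1
  simp only [h4] at h2
  simp only [fun n => (hfg n).2.2 i φ hφ hc] at h1
  exact tendsto_nhds_unique h1 h2.neg

end WeakGradient

theorem lintegral_enorm_sub_sq_le {α F : Type*} [MeasurableSpace α] {μ : Measure α}
    [NormedAddCommGroup F] {f : α → F} (hf : AEStronglyMeasurable f μ) (g : α → F) :
    ∫⁻ x, ‖f x - g x‖ₑ ^ 2 ∂μ ≤ 4 * (∫⁻ x, ‖f x‖ₑ ^ 2 ∂μ + ∫⁻ x, ‖g x‖ₑ ^ 2 ∂μ) := by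
  rw [← lintegral_add_left' (hf.enorm.pow_const 2), ← lintegral_const_mul' _ _ (by simp)]
  refine lintegral_mono fun x => ?_
  exact (pow_le_pow_left' enorm_sub_le 2).trans (ENNReal.add_sq_le_four_mul _ _)

section GaussWeightConversion

variable {E : Type*} [NormedAddCommGroup E] [InnerProductSpace ℝ E] [FiniteDimensional ℝ E]
  [MeasurableSpace E] [BorelSpace E]

theorem lintegral_ofReal_exp_mul_norm_sq {F : Type*} [NormedAddCommGroup F] (f : E → F) :
    ∫⁻ x, ENNReal.ofReal (Real.exp (-‖x‖ ^ 2 / 2) * ‖f x‖ ^ 2) =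
      ∫⁻ x, ‖f x‖ₑ ^ 2 ∂gaussWeight E := by
  rw [lintegral_gaussWeight]
  refine lintegral_congr fun x => ?_
  rw [ENNReal.ofReal_mul (Real.exp_pos _).le, ENNReal.ofReal_pow (norm_nonneg _),
    ofReal_norm]

end GaussWeightConversion

/-- Compactness of the embedding `H ↪ L²(e^{-|x|²/2}dx)`: if `(ψ_n)` have weak
gradients `(g_n)` with uniformly bounded Gaussian Dirichlet energy and the normalization
`∫ (1+|x|²) e^{-|x|²/2} ψ_n dx = 0`, then a subsequence converges in `L²(e^{-|x|²/2}dx)` to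
some `ψ` of finite Gaussian Dirichlet energy. -/
theorem stmt9 (N : ℕ) (hN : 1 ≤ N)
    (ψ : ℕ → EuclideanSpace ℝ (Fin N) → ℝ)
    (g : ℕ → EuclideanSpace ℝ (Fin N) → EuclideanSpace ℝ (Fin N))
    (hwg : ∀ n, HasWeakGradient N (ψ n) (g n))
    (B : ℝ)
    (hB : ∀ n, (∫⁻ x, ENNReal.ofReal (Real.exp (-‖x‖ ^ 2 / 2) * ‖g n x‖ ^ 2))
      ≤ ENNReal.ofReal B)
    (hint : ∀ n, Integrable (fun x : EuclideanSpace ℝ (Fin N) =>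
      (1 + ‖x‖ ^ 2) * Real.exp (-‖x‖ ^ 2 / 2) * ψ n x))
    (hzero : ∀ n, (∫ x : EuclideanSpace ℝ (Fin N),
      (1 + ‖x‖ ^ 2) * Real.exp (-‖x‖ ^ 2 / 2) * ψ n x) = 0) :
    ∃ nk : ℕ → ℕ, StrictMono nk ∧
      ∃ (ψ' : EuclideanSpace ℝ (Fin N) → ℝ)
        (g' : EuclideanSpace ℝ (Fin N) → EuclideanSpace ℝ (Fin N)),
        HasWeakGradient N ψ' g' ∧
        (∫⁻ x, ENNReal.ofReal (Real.exp (-‖x‖ ^ 2 / 2) * ‖g' x‖ ^ 2)) < ⊤ ∧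
        Tendsto (fun j => ∫⁻ x,
            ENNReal.ofReal (Real.exp (-‖x‖ ^ 2 / 2) * (ψ (nk j) x - ψ' x) ^ 2))
          atTop (nhds 0) := by
  set γ := gaussWeight (EuclideanSpace ℝ (Fin N)) with hγ
  simp only [lintegral_ofReal_exp_mul_norm_sq, ← hγ] at hB ⊢
  have hψm : ∀ n, AEStronglyMeasurable (ψ n) γ := fun n =>
    (hwg n).1.aestronglyMeasurable.mono_ac gaussWeight_absolutelyContinuous
  have hgm : ∀ n, AEStronglyMeasurable (g n) γ := fun n =>
    (hwg n).2.1.aestronglyMeasurable.mono_ac gaussWeight_absolutelyContinuous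
  have hcomm : ∀ n (x : EuclideanSpace ℝ (Fin N)),
      (1 + ‖x‖ ^ 2) * Real.exp (-‖x‖ ^ 2 / 2) * ψ n x =
        Real.exp (-‖x‖ ^ 2 / 2) • ((1 + ‖x‖ ^ 2) * ψ n x) := fun n x => by
    rw [smul_eq_mul]
    ring
  simp only [hcomm] at hint hzero
  obtain ⟨C, hC, hpoinc⟩ := exists_lintegral_sq_le N
  have hψb : ∀ n, ∫⁻ x, ‖ψ n x‖ₑ ^ 2 ∂γ ≤ C * ENNReal.ofReal B := fun n =>
    (hpoinc _ _ (hwg n) (integrable_gaussWeight_iff.2 (hint n))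
      (by rw [integral_gaussWeight, hzero n])).trans (mul_le_mul_right (hB n) C)
  have hCB : C * ENNReal.ofReal B ≠ ∞ := ENNReal.mul_ne_top hC ENNReal.ofReal_ne_top
  obtain ⟨ψ', φ₁, hψ', hφ₁, hψw⟩ := exists_subseq_tendsto_integral_inner ψ hψm hCB hψb
  obtain ⟨g', φ₂, hg', hφ₂, hgw⟩ := exists_subseq_tendsto_integral_inner (fun n => g (φ₁ n))
    (fun n => hgm _) ENNReal.ofReal_ne_top (fun n => hB _)
  have hψw' : ∀ w : EuclideanSpace ℝ (Fin N) → ℝ, MemLp w 2 γ →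
      Tendsto (fun n => ∫ x, ψ (φ₁ (φ₂ n)) x * w x ∂γ) atTop (nhds (∫ x, ψ' x * w x ∂γ)) := by
    intro w hw
    have h := (hψw w hw).comp hφ₂.tendsto_atTop
    simpa [Function.comp_def, mul_comm] using! h
  have hgrad : HasWeakGradient N ψ' g' :=
    hasWeakGradient_of_tendsto (fun n => hwg (φ₁ (φ₂ n))) hψ' hg' hψw' hgw
  have hg'f := (memLp_two_iff_lintegral_lt_top hg'.aestronglyMeasurable).1 hg'
  have hψ'f := (memLp_two_iff_lintegral_lt_top hψ'.aestronglyMeasurable).1 hψ'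
  refine ⟨fun n => φ₁ (φ₂ n), hφ₁.comp hφ₂, ψ', g', hgrad, hg'f, ?_⟩
  have hconv : ∀ f : EuclideanSpace ℝ (Fin N) → ℝ,
      ∫⁻ x, ENNReal.ofReal (Real.exp (-‖x‖ ^ 2 / 2) * f x ^ 2) = ∫⁻ x, ‖f x‖ₑ ^ 2 ∂γ := fun f => by
    rw [← lintegral_ofReal_exp_mul_norm_sq]
    simp only [Real.norm_eq_abs, sq_abs]
  rw [show (fun j => ∫⁻ x, ENNReal.ofReal (Real.exp (-‖x‖ ^ 2 / 2) *
    (ψ (φ₁ (φ₂ j)) x - ψ' x) ^ 2)) = fun j => ∫⁻ x, ‖ψ (φ₁ (φ₂ j)) x - ψ' x‖ₑ ^ 2 ∂γ from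
    funext fun j => hconv _]
  refine tendsto_lintegral_sq_of_weakly_null (fun n => (hwg (φ₁ (φ₂ n))).sub hgrad)
    (M := 4 * (C * ENNReal.ofReal B + ∫⁻ x, ‖ψ' x‖ₑ ^ 2 ∂γ))
    (D := 4 * (ENNReal.ofReal B + ∫⁻ x, ‖g' x‖ₑ ^ 2 ∂γ)) (by finiteness) (by finiteness)
    (fun n => (lintegral_enorm_sub_sq_le (hψm _) _).trans (by gcongr; exact hψb _))
    (fun n => (lintegral_enorm_sub_sq_le (hgm _) _).trans (by gcongr; exact hB _)) fun w hw => ?_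
  have hψL : ∀ n, MemLp (ψ n) 2 γ := fun n =>
    (memLp_two_iff_lintegral_lt_top (hψm n)).2 ((hψb n).trans_lt hCB.lt_top)
  have h := (hψw' w hw).sub_const (∫ x, ψ' x * w x ∂γ)
  rw [sub_self] at h
  refine h.congr fun n => ?_
  simp only [sub_mul]
  exact (integral_sub ((hψL _).integrable_mul hw) (hψ'.integrable_mul hw)).symm
end
end

section
/- Let N ≥ 1, m > 1, and let v : ℝ^N → (0,∞) be a smooth positive function such that v, v^m, |x|²v, |∇(v^{m-1/2})|² and |x|·v^{m-1}|∇v| are integrable with sufficient decay at infinity for integration by parts (e.g. v is a Schwartz function that is everywhere positive). Then, with θ = 2m²/((2m-1)(N(m-1)+1)), (N(m-1)+1)·[ (θ/(2m-1)) ∫_{ℝ^N} |∇(v^{m-1/2})|² dx + (1/2)∫_{ℝ^N} |x|² v dx ] - (1/2)∫_{ℝ^N} v |∇( (m/(m-1)) v^{m-1} + |x|²/2 )|² dx = N(m-1)·[ (1/(m-1)) ∫_{ℝ^N} v^m dx + (1/2)∫_{ℝ^N} |x|² v dx ]. -/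
open MeasureTheory Real Filter ENNReal

noncomputable section

section Gradient

variable {E : Type*} [NormedAddCommGroup E] [InnerProductSpace ℝ E]

theorem HasGradientAt.rpow_const_of_ne_zero [CompleteSpace E] {f : E → ℝ} {g x : E}
    (h : HasGradientAt f g x) (hx : f x ≠ 0) (p : ℝ) :
    HasGradientAt (fun y => f y ^ p) ((p * f x ^ (p - 1)) • g) x := by
  rw [hasGradientAt_iff_hasFDerivAt, map_smulₛₗ]
  exact h.hasFDerivAt.rpow_const (Or.inl hx)

theorem hasGradientAt_half_norm_sq [CompleteSpace E] (x : E) :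
    HasGradientAt (fun y : E => ‖y‖ ^ 2 / 2) x x := by
  rw [hasGradientAt_iff_hasFDerivAt]
  have h := (hasStrictFDerivAt_norm_sq x).hasFDerivAt.mul_const (2⁻¹ : ℝ)
  simp only [← div_eq_mul_inv] at h
  refine h.congr_fderiv ?_
  ext y
  simp

/-- The divergence theorem for the radial field `x ↦ w x • x`. -/
theorem integral_inner_self_gradient [FiniteDimensional ℝ E] [MeasurableSpace E] [BorelSpace E]
    {w : E → ℝ} (hd : Differentiable ℝ w) (hw : Integrable w)
    (hxw : Integrable fun x => ‖x‖ * w x) (hxg : Integrable fun x => ‖x‖ * ‖gradient w x‖) :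
    ∫ x, inner ℝ x (gradient w x) = -(Module.finrank ℝ E * ∫ x, w x) := by
  set b := stdOrthonormalBasis ℝ E
  have hfg' (i) : Integrable fun x => inner ℝ (b i) x * fderiv ℝ w x (b i) := by
    refine hxg.mono' ?_ (.of_forall fun x => ?_)
    · exact (by fun_prop : Continuous fun x => inner ℝ (b i) x).aestronglyMeasurable.mul
        (measurable_fderiv_apply_const ℝ w (b i)).aestronglyMeasurable
    · rw [norm_mul, ← inner_gradient_left]
      gcongr
      · simpa using norm_inner_le_norm (𝕜 := ℝ) (b i) x
      · simpa using norm_inner_le_norm (𝕜 := ℝ) (gradient w x) (b i)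
  have hfd (i) (x : E) : fderiv ℝ (fun x => inner ℝ (b i) x) x (b i) = 1 := by
    have h : HasFDerivAt (fun x => inner ℝ (b i) x) (innerSL ℝ (b i)) x :=
      (innerSL ℝ (b i)).hasFDerivAt
    simp [h.fderiv]
  have hparts (i) : ∫ x, inner ℝ (b i) x * fderiv ℝ w x (b i) = -∫ x, w x := by
    rw [integral_mul_fderiv_eq_neg_fderiv_mul_of_integrable _ (hfg' i)]
    · simp [hfd]
    · refine hxw.norm.mono' ?_ (.of_forall fun x => ?_)
      · exact (by fun_prop : Continuous fun x => inner ℝ (b i) x).aestronglyMeasurable.mul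
          hw.aestronglyMeasurable
      · rw [norm_mul, norm_mul, norm_norm]
        gcongr
        simpa using norm_inner_le_norm (𝕜 := ℝ) (b i) x
    · exact fun x _ => (innerSL ℝ (b i)).differentiableAt
    · exact fun x _ => hd x
    · simpa [hfd] using hw
  have hsum (x : E) :
      inner ℝ x (gradient w x) = ∑ i, inner ℝ (b i) x * fderiv ℝ w x (b i) := by
    rw [← b.sum_inner_mul_inner]
    simp only [inner_gradient_right, real_inner_comm, RCLike.conj_to_real]
  simp_rw [hsum]
  rw [integral_finsetSum _ fun i _ => hfg' i]
  simp [hparts]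

end Gradient

/-- Entropy–information relation for `m > 1`: for a smooth positive `v`
with sufficient integrability and decay (e.g. a positive Schwartz function), with
`θ = 2m²/((2m-1)(N(m-1)+1))`,
`(N(m-1)+1)[(θ/(2m-1))∫|∇(v^{m-1/2})|² + (1/2)∫|x|²v]
  - (1/2)∫ v|∇((m/(m-1))v^{m-1} + |x|²/2)|²
  = N(m-1)[(1/(m-1))∫v^m + (1/2)∫|x|²v]`. -/
theorem stmt12 (N : ℕ) (hN : 1 ≤ N) (m : ℝ) (hm : 1 < m)
    (v : EuclideanSpace ℝ (Fin N) → ℝ) (hpos : ∀ x, 0 < v x)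
    (hSchwartz : ∃ S : SchwartzMap (EuclideanSpace ℝ (Fin N)) ℝ, ∀ x, S x = v x)
    (hint1 : Integrable v)
    (hint2 : Integrable (fun x : EuclideanSpace ℝ (Fin N) => (v x) ^ m))
    (hint3 : Integrable (fun x : EuclideanSpace ℝ (Fin N) => ‖x‖ ^ 2 * v x))
    (hint4 : Integrable (fun x : EuclideanSpace ℝ (Fin N) =>
      ‖gradient (fun y => (v y) ^ (m - 1 / 2)) x‖ ^ 2))
    (hint5 : Integrable (fun x : EuclideanSpace ℝ (Fin N) =>
      ‖x‖ * (v x) ^ (m - 1) * ‖gradient v x‖))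
    (θ : ℝ) (hθ : θ = 2 * m ^ 2 / ((2 * m - 1) * ((N : ℝ) * (m - 1) + 1))) :
    ((N : ℝ) * (m - 1) + 1) *
        ((θ / (2 * m - 1)) * (∫ x, ‖gradient (fun y => (v y) ^ (m - 1 / 2)) x‖ ^ 2)
          + (1 / 2) * ∫ x, ‖x‖ ^ 2 * v x)
      - (1 / 2) * (∫ x, v x *
          ‖gradient (fun y => (m / (m - 1)) * (v y) ^ (m - 1) + ‖y‖ ^ 2 / 2) x‖ ^ 2)
      = (N : ℝ) * (m - 1) *
          ((1 / (m - 1)) * (∫ x, (v x) ^ m) + (1 / 2) * ∫ x, ‖x‖ ^ 2 * v x) := by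
  obtain ⟨S, hS⟩ := hSchwartz
  obtain rfl : ⇑S = v := funext hS
  have hgrad (x) : HasGradientAt S (gradient S x) x := S.differentiableAt.hasGradientAt
  have hpow (p : ℝ) (x) := (hgrad x).rpow_const_of_ne_zero (hpos x).ne' p
  have hmul (x) (p q : ℝ) : S x ^ p * S x ^ q = S x ^ (p + q) := (rpow_add (hpos x) p q).symm
  have hm0 : m - 1 ≠ 0 := by linarith
  have hm1 : 2 * m - 1 ≠ 0 := by linarith
  have hgradm (x) : gradient (fun y => S y ^ m) x = (m * S x ^ (m - 1)) • gradient S x :=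
    (hpow m x).gradient
  have hxg : Integrable fun x => ‖x‖ * ‖gradient (fun y => S y ^ m) x‖ := by
    refine (hint5.const_mul m).congr (.of_forall fun x => ?_)
    have h : 0 ≤ m * S x ^ (m - 1) := mul_nonneg (by linarith) (rpow_nonneg (hpos x).le _)
    simp only [hgradm, norm_smul, Real.norm_of_nonneg h]
    ring
  have hxw : Integrable fun x => ‖x‖ * S x ^ m := by
    set C := SchwartzMap.seminorm ℝ 0 0 S
    refine (hint2.add (hint3.const_mul (C ^ (m - 1)))).mono'
      (continuous_norm.aestronglyMeasurable.mul hint2.aestronglyMeasurable)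
      (.of_forall fun x => ?_)
    have hC : S x ≤ C := (le_abs_self _).trans (S.norm_le_seminorm ℝ x)
    have hle : S x ^ (m - 1) ≤ C ^ (m - 1) := rpow_le_rpow (hpos x).le hC (by linarith)
    have hsplit : S x ^ m = S x ^ (m - 1) * S x := by
      rw [← rpow_add_one (hpos x).ne', sub_add_cancel]
    have hm' : 0 ≤ S x ^ m := rpow_nonneg (hpos x).le _
    rw [Real.norm_of_nonneg (by positivity)]
    calc ‖x‖ * S x ^ m ≤ (1 + ‖x‖ ^ 2) * S x ^ m := by
          gcongr
          nlinarith [sq_nonneg (‖x‖ - 1), sq_nonneg ‖x‖]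
      _ = S x ^ m + S x ^ (m - 1) * (‖x‖ ^ 2 * S x) := by rw [hsplit]; ring
      _ ≤ S x ^ m + C ^ (m - 1) * (‖x‖ ^ 2 * S x) := by
          gcongr
          exact mul_nonneg (sq_nonneg _) (hpos x).le
  have hparts := integral_inner_self_gradient
    (fun x => (hpow m x).differentiableAt) hint2 hxw hxg
  rw [finrank_euclideanSpace_fin] at hparts
  have hcross : Integrable fun x => inner ℝ x (gradient (fun y => S y ^ m) x) := by
    refine hxg.mono' ?_ (.of_forall fun x => norm_inner_le_norm _ _)
    exact (measurable_id.inner ((InnerProductSpace.toDual ℝ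
      (EuclideanSpace ℝ (Fin N))).symm.continuous.measurable.comp
        (measurable_fderiv ℝ _))).aestronglyMeasurable
  have hexpand (x) :
      S x * ‖gradient (fun y => (m / (m - 1)) * S y ^ (m - 1) + ‖y‖ ^ 2 / 2) x‖ ^ 2
        = 4 * m ^ 2 / (2 * m - 1) ^ 2 * ‖gradient (fun y => S y ^ (m - 1 / 2)) x‖ ^ 2
          + 2 * inner ℝ x (gradient (fun y => S y ^ m) x) + ‖x‖ ^ 2 * S x := by
    have hg : gradient (fun y => (m / (m - 1)) * S y ^ (m - 1) + ‖y‖ ^ 2 / 2) x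
        = (m * S x ^ (m - 1 - 1)) • gradient S x + x := by
      refine HasGradientAt.gradient ?_
      have h := ((hpow (m - 1) x).hasFDerivAt.const_mul (m / (m - 1))).add
        (hasGradientAt_half_norm_sq x).hasFDerivAt
      rw [hasGradientAt_iff_hasFDerivAt]
      refine h.congr_fderiv ?_
      ext y
      simp
      field_simp
    have h1 : S x * S x ^ (m - 1 - 1) = S x ^ (m - 1) := by
      rw [mul_comm, ← rpow_add_one (hpos x).ne', sub_add_cancel]
    have h2 : (S x ^ (m - 1 / 2 - 1)) ^ 2 = S x ^ (m - 1) * S x ^ (m - 1 - 1) := by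
      rw [sq, hmul, hmul]
      ring_nf
    rw [hg, hgradm, (hpow (m - 1 / 2) x).gradient, norm_add_sq_real, norm_smul, norm_smul,
      inner_smul_left, inner_smul_right, mul_pow, mul_pow, real_inner_comm x]
    simp only [Real.norm_eq_abs, sq_abs, RCLike.conj_to_real, mul_pow, h2]
    rw [← h1]
    have h3 : 4 * m ^ 2 / (2 * m - 1) ^ 2 * (m - 1 / 2) ^ 2 = m ^ 2 := by
      rw [div_mul_eq_mul_div, div_eq_iff (pow_ne_zero 2 hm1)]
      ring
    linear_combination
      -(S x * S x ^ (m - 1 - 1) * S x ^ (m - 1 - 1) * ‖gradient S x‖ ^ 2) * h3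
  simp_rw [hexpand]
  rw [integral_add (by exact (hint4.const_mul _).add (hcross.const_mul 2)) hint3,
    integral_add (hint4.const_mul _) (hcross.const_mul 2), integral_const_mul,
    integral_const_mul, hparts, hθ]
  have hNm : (N : ℝ) * (m - 1) + 1 ≠ 0 := by
    have : 0 ≤ (N : ℝ) * (m - 1) := mul_nonneg N.cast_nonneg (by linarith)
    linarith
  field_simp
  ring
end
end

section
/- Let N ≥ 1 and C > 0, and define u : (0,∞) × ℝ^N → (0,∞) by u(t,x) = C·t^{-N/4}·exp( -|x|²/(2√2·√t) ). Then u is a smooth positive solution of the fourth-order quantum drift-diffusion equation ∂_t u + div( u ∇( u^{-1/2} Δ(u^{1/2}) ) ) = 0 on (0,∞) × ℝ^N. -/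
open MeasureTheory Real Filter ENNReal

noncomputable section

/-- The `i`-th partial derivative of `f` at `x`. -/
def pdv (N : ℕ) (f : EuclideanSpace ℝ (Fin N) → ℝ) (i : Fin N)
    (x : EuclideanSpace ℝ (Fin N)) : ℝ :=
  fderiv ℝ f x (EuclideanSpace.single i 1)

/-- The Laplacian of `f` at `x`. -/
def lap (N : ℕ) (f : EuclideanSpace ℝ (Fin N) → ℝ)
    (x : EuclideanSpace ℝ (Fin N)) : ℝ :=
  ∑ i, pdv N (pdv N f i) i x

/-- The porous medium displacement Hessian
`(H_E ψ)(x) = -((m-1)/2)(1-|x|²)Δψ(x) + x·∇ψ(x)`. -/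
def HE (N : ℕ) (m : ℝ) (f : EuclideanSpace ℝ (Fin N) → ℝ)
    (x : EuclideanSpace ℝ (Fin N)) : ℝ :=
  -((m - 1) / 2) * (1 - ‖x‖ ^ 2) * lap N f x + ∑ i, x i * pdv N f i x

/-- The real Gaussian `K exp(-b|x|²)`. -/
def gaussian (N : ℕ) (K b : ℝ) (x : EuclideanSpace ℝ (Fin N)) : ℝ :=
  K * Real.exp (-b * ‖x‖ ^ 2)

theorem gaussian_pos {N : ℕ} {K : ℝ} (hK : 0 < K) (b : ℝ) (x : EuclideanSpace ℝ (Fin N)) :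
    0 < gaussian N K b x :=
  mul_pos hK (Real.exp_pos _)

theorem gaussian_rpow {N : ℕ} {K : ℝ} (hK : 0 < K) (b p : ℝ) (x : EuclideanSpace ℝ (Fin N)) :
    gaussian N K b x ^ p = gaussian N (K ^ p) (p * b) x := by
  rw [gaussian, Real.mul_rpow hK.le (Real.exp_pos _).le, ← Real.exp_mul, gaussian]
  ring_nf

theorem hasFDerivAt_gaussian (N : ℕ) (K b : ℝ) (x : EuclideanSpace ℝ (Fin N)) :
    HasFDerivAt (gaussian N K b) ((-2 * b * gaussian N K b x) • innerSL ℝ x) x := by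
  have h := (((hasStrictFDerivAt_norm_sq x).hasFDerivAt.const_mul (-b)).exp).const_mul K
  refine h.congr_fderiv ?_
  ext v
  simp [gaussian]
  ring

theorem pdv_gaussian (N : ℕ) (K b : ℝ) (i : Fin N) :
    pdv N (gaussian N K b) i = fun x => -2 * b * (x i * gaussian N K b x) := by
  funext x
  rw [pdv, (hasFDerivAt_gaussian N K b x).fderiv]
  simp [EuclideanSpace.inner_single_right]
  ring

theorem pdv_const_mul_coord_mul_gaussian (N : ℕ) (c K b : ℝ) (i : Fin N)
    (x : EuclideanSpace ℝ (Fin N)) :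
    pdv N (fun y => c * (y i * gaussian N K b y)) i x =
      c * ((1 - 2 * b * x i ^ 2) * gaussian N K b x) := by
  have hi : HasFDerivAt (fun y : EuclideanSpace ℝ (Fin N) => y i)
      (EuclideanSpace.proj i : EuclideanSpace ℝ (Fin N) →L[ℝ] ℝ) x :=
    (EuclideanSpace.proj i : EuclideanSpace ℝ (Fin N) →L[ℝ] ℝ).hasFDerivAt
  have h := (hi.mul (hasFDerivAt_gaussian N K b x)).const_mul c
  refine (congrArg (fun L => L (EuclideanSpace.single i 1)) h.fderiv).trans ?_
  simp [EuclideanSpace.inner_single_right]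
  ring

theorem sum_pdv_const_mul_coord_mul_gaussian (N : ℕ) (c K b : ℝ)
    (x : EuclideanSpace ℝ (Fin N)) :
    ∑ i, pdv N (fun y => c * (y i * gaussian N K b y)) i x =
      c * ((N - 2 * b * ‖x‖ ^ 2) * gaussian N K b x) := by
  simp only [pdv_const_mul_coord_mul_gaussian]
  rw [← Finset.mul_sum, ← Finset.sum_mul, Finset.sum_sub_distrib, ← Finset.mul_sum,
    EuclideanSpace.real_norm_sq_eq]
  simp

theorem lap_gaussian (N : ℕ) (K b : ℝ) (x : EuclideanSpace ℝ (Fin N)) :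
    lap N (gaussian N K b) x = -2 * b * ((N - 2 * b * ‖x‖ ^ 2) * gaussian N K b x) := by
  simp only [lap, pdv_gaussian]
  exact sum_pdv_const_mul_coord_mul_gaussian N (-2 * b) K b x

/-- The Bohm potential of a Gaussian is a quadratic polynomial. -/
theorem rpow_mul_lap_rpow_gaussian (N : ℕ) {K : ℝ} (hK : 0 < K) (a : ℝ)
    (x : EuclideanSpace ℝ (Fin N)) :
    gaussian N K a x ^ (-(1 : ℝ) / 2) *
      lap N (fun w => gaussian N K a w ^ ((1 : ℝ) / 2)) x = a ^ 2 * ‖x‖ ^ 2 - a * N := by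
  have hfun : (fun w => gaussian N K a w ^ ((1 : ℝ) / 2)) =
      gaussian N (K ^ ((1 : ℝ) / 2)) (1 / 2 * a) :=
    funext fun w => gaussian_rpow hK a _ w
  rw [hfun, lap_gaussian, ← gaussian_rpow hK]
  have h : gaussian N K a x ^ (-(1 : ℝ) / 2) * gaussian N K a x ^ ((1 : ℝ) / 2) = 1 := by
    rw [← Real.rpow_add (gaussian_pos hK a x)]
    norm_num
  linear_combination (a ^ 2 * ‖x‖ ^ 2 - a * N) * h

theorem gradient_const_mul_norm_sq_sub_apply (N : ℕ) (c d : ℝ) (x : EuclideanSpace ℝ (Fin N))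
    (i : Fin N) :
    gradient (fun z : EuclideanSpace ℝ (Fin N) => c * ‖z‖ ^ 2 - d) x i = 2 * c * x i := by
  have h : HasGradientAt (fun z : EuclideanSpace ℝ (Fin N) => c * ‖z‖ ^ 2 - d)
      ((2 * c) • x) x := by
    rw [hasGradientAt_iff_hasFDerivAt]
    refine (((hasStrictFDerivAt_norm_sq x).hasFDerivAt.const_mul c).sub_const d).congr_fderiv ?_
    ext v
    simp
    ring
  rw [h.gradient]
  simp

theorem sum_pdv_gaussian_mul_gradient (N : ℕ) {K : ℝ} (hK : 0 < K) (a : ℝ)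
    (x : EuclideanSpace ℝ (Fin N)) :
    ∑ i, pdv N (fun y => gaussian N K a y *
        gradient (fun z => gaussian N K a z ^ (-(1 : ℝ) / 2) *
          lap N (fun w => gaussian N K a w ^ ((1 : ℝ) / 2)) z) y i) i x =
      2 * a ^ 2 * ((N - 2 * a * ‖x‖ ^ 2) * gaussian N K a x) := by
  rw [← sum_pdv_const_mul_coord_mul_gaussian]
  simp only [rpow_mul_lap_rpow_gaussian N hK, gradient_const_mul_norm_sq_sub_apply]
  refine Finset.sum_congr rfl fun i _ => ?_
  congr 1
  funext y
  ring

/-- The self-similar Gaussian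
`u(t,x) = C t^{-N/4} exp(-|x|²/(2√2 √t))` is a smooth positive solution of the fourth-order
quantum drift-diffusion equation `∂_t u + div(u ∇(u^{-1/2} Δ(u^{1/2}))) = 0` on
`(0,∞) × ℝ^N`. -/
theorem stmt19 (N : ℕ) (hN : 1 ≤ N) (C : ℝ) (hC : 0 < C)
    (u : ℝ → EuclideanSpace ℝ (Fin N) → ℝ)
    (hu : u = fun t x => C * t ^ (-(N : ℝ) / 4) *
      Real.exp (-‖x‖ ^ 2 / (2 * Real.sqrt 2 * Real.sqrt t))) :
    (∀ t > (0 : ℝ), ∀ x, 0 < u t x) ∧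
    ContDiffOn ℝ (⊤ : ℕ∞) (fun p : ℝ × EuclideanSpace ℝ (Fin N) => u p.1 p.2)
      (Set.Ioi 0 ×ˢ Set.univ) ∧
    (∀ t > (0 : ℝ), ∀ x : EuclideanSpace ℝ (Fin N),
      deriv (fun s => u s x) t +
        (∑ i, pdv N (fun y => u t y *
          gradient (fun z =>
            (u t z) ^ (-(1 : ℝ) / 2) * lap N (fun w => (u t w) ^ ((1 : ℝ) / 2)) z) y i)
          i x)
        = 0) := by
  have hg : ∀ t, u t = gaussian N (C * t ^ (-(N : ℝ) / 4)) (1 / (2 * √2 * √t)) := by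
    intro t
    funext x
    simp only [hu, gaussian]
    ring_nf
  have hK : ∀ t > (0 : ℝ), 0 < C * t ^ (-(N : ℝ) / 4) := fun t ht =>
    mul_pos hC (Real.rpow_pos_of_pos ht _)
  refine ⟨fun t ht x => ?_, ?_, fun t ht x => ?_⟩
  · rw [hg]
    exact gaussian_pos (hK t ht) _ x
  · intro p hp
    have hp0 : 0 < p.1 := hp.1
    have hs : 2 * √2 * √p.1 ≠ 0 := by positivity
    subst hu
    refine ContDiffAt.contDiffWithinAt ?_
    refine (contDiffAt_const.mul (contDiffAt_fst.rpow_const_of_ne hp0.ne')).mul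
      (ContDiffAt.exp (ContDiffAt.div (contDiffAt_snd.norm_sq ℝ).neg
        (contDiffAt_const.mul (contDiffAt_fst.sqrt hp0.ne')) hs))
  · rw [hg t, sum_pdv_gaussian_mul_gradient N (hK t ht)]
    have hst : √t ≠ 0 := (Real.sqrt_pos.2 ht).ne'
    have hs : 2 * √2 * √t ≠ 0 := by positivity
    have hd : HasDerivAt (fun s => u s x)
        ((-(N : ℝ) / (4 * t) + ‖x‖ ^ 2 / (4 * √2 * √t ^ 3)) * u t x) t := by
      have h1 := (Real.hasDerivAt_rpow_const (p := -(N : ℝ) / 4) (Or.inl ht.ne')).const_mul C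
      have h2 := ((hasDerivAt_const t (-‖x‖ ^ 2)).div
        ((Real.hasDerivAt_sqrt ht.ne').const_mul (2 * √2)) hs).exp
      subst hu
      refine (h1.mul h2).congr_deriv ?_
      rw [Real.rpow_sub_one ht.ne']
      have h2' : √2 ≠ 0 := by positivity
      simp only [Pi.div_apply]
      field_simp
      ring
    rw [hd.deriv, hg t]
    have h2 : √2 ^ 2 = 2 := Real.sq_sqrt (by norm_num)
    have htt : √t ^ 2 = t := Real.sq_sqrt ht.le
    have ha : (1 / (2 * √2 * √t)) ^ 2 = 1 / (8 * t) := by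
      rw [div_pow, mul_pow, mul_pow, h2, htt]
      norm_num
    rw [ha, pow_succ √t 2, htt]
    field_simp
    ring
end
end
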